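/- arXiv:1706.09058 — 3 statements merged into one kernel-verified Lean document; each statement's English description precedes it below -/
import Mathlib

section
/- Let {a_n} be a sequence of positive real numbers such that ∑ 1/a_n diverges. Then for every sequence {b_n} of positive reals and every natural number n_0, there exists n' > n_0 such that b_{n'} * a_{n'+1} - b_{n'+1} * a_{n'} < a_{n'}. -/
/-- Consequence of Kummer's test for sequences with divergent reciprocal series. -/
theorem kummer_divergence_consequence (a : ℕ → ℝ) (ha : ∀ n, 0 < a n)
    (hdiv : ¬ Summable (fun n => 1 / a n)) (b : ℕ → ℝ) (hb : ∀ n, 0 < b n) (n₀ : ℕ) :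
    ∃ n' > n₀, b n' * a (n' + 1) - b (n' + 1) * a n' < a n' := by
  by_contra hcon
  have h : ∀ n, n₀ < n → a n ≤ b n * a (n + 1) - b (n + 1) * a n := by
    intro n hn
    by_contra hlt
    exact hcon ⟨n, hn, not_le.mp hlt⟩
  have step : ∀ n, n₀ < n → 1 / a (n + 1) ≤ b n / a n - b (n + 1) / a (n + 1) := by
    intro n hn
    have h1 := ha n
    have h2 := ha (n + 1)
    rw [div_sub_div _ _ h1.ne' h2.ne', div_le_div_iff₀ h2 (mul_pos h1 h2)]
    have := mul_le_mul_of_nonneg_right (h n hn) h2.le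
    linarith
  apply hdiv
  rw [← summable_nat_add_iff (n₀ + 2)]
  have key : ∀ k, ∑ i ∈ Finset.range k, 1 / a (i + (n₀ + 2)) ≤
      b (n₀ + 1) / a (n₀ + 1) - b (k + (n₀ + 1)) / a (k + (n₀ + 1)) := by
    intro k
    induction k with
    | zero => simp
    | succ k ih =>
      rw [Finset.sum_range_succ]
      have := step (k + (n₀ + 1)) (by omega)
      rw [show k + 1 + (n₀ + 1) = k + (n₀ + 1) + 1 by omega,
        show k + (n₀ + 2) = k + (n₀ + 1) + 1 by omega]
      linarith
  refine summable_of_sum_range_le (c := b (n₀ + 1) / a (n₀ + 1)) ?_ ?_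
  · intro i
    exact (one_div_pos.mpr (ha _)).le
  · intro k
    have := div_pos (hb (k + (n₀ + 1))) (ha (k + (n₀ + 1)))
    linarith [key k]
end

section
/- For infinitely many natural numbers n, p_{n+1} - p_n < (n+1) log(n+1) - n log n + 1, where p_n is the n-th prime. -/
/-- `p n` is the `n`-th prime number (1-indexed), as a real number. -/
noncomputable def p (n : ℕ) : ℝ := Nat.nth Nat.Prime (n - 1)

open Finset in
lemma bonf {ι : Type*} [DecidableEq ι] (g : ι → ℝ) (S : Finset ι) (h0 : ∀ p ∈ S, 0 ≤ g p)
    (h1 : ∀ p ∈ S, g p ≤ 1) (K : ℕ) :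
    0 ≤ (-1 : ℝ) ^ K * (∏ p ∈ S, (1 - g p)
      - ∑ d ∈ S.powerset, if d.card < K then ∏ p ∈ d, (-g p) else 0) ∧
    (-1 : ℝ) ^ K * (∏ p ∈ S, (1 - g p)
      - ∑ d ∈ S.powerset, if d.card < K then ∏ p ∈ d, (-g p) else 0) ≤
      ∑ d ∈ S.powerset, if d.card = K then ∏ p ∈ d, g p else 0 := by
  induction S using Finset.induction_on generalizing K with
  | empty =>
    rcases K with _ | K
    · simp
    · simp
  | insert p S hp ih =>
    have ih' := ih (fun q hq => h0 q (mem_insert_of_mem hq)) (fun q hq => h1 q (mem_insert_of_mem hq))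
    have hg0 := h0 p (mem_insert_self _ _)
    have hg1 := h1 p (mem_insert_self _ _)
    have hcard : ∀ d ∈ S.powerset, (insert p d).card = d.card + 1 := by
      intro d hd
      rw [card_insert_of_notMem]
      intro h; exact hp (mem_powerset.1 hd h)
    have hprod : ∀ f : ι → ℝ, ∀ d ∈ S.powerset, ∏ q ∈ insert p d, f q = f p * ∏ q ∈ d, f q := by
      intro f d hd
      rw [prod_insert]
      intro h; exact hp (mem_powerset.1 hd h)
    rw [prod_insert hp, sum_powerset_insert hp, sum_powerset_insert hp]
    rcases K with _ | K
    · have a := ih' 0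
      simp only [pow_zero, one_mul, Nat.not_lt_zero, if_false, sum_const_zero, sub_zero,
        add_zero] at a ⊢
      constructor
      · exact mul_nonneg (by linarith) a.1
      · have : ∑ t ∈ S.powerset, (if (insert p t).card = 0 then ∏ q ∈ insert p t, g q else 0) = 0 := by
          apply sum_eq_zero
          intro d hd
          rw [hcard d hd]; simp
        rw [this]
        nlinarith [a.1, a.2]
    · have a := ih' K
      have b := ih' (K+1)
      have e1 : ∑ t ∈ S.powerset, (if (insert p t).card < K + 1 then ∏ q ∈ insert p t, (-g q) else 0)
          = - g p * ∑ t ∈ S.powerset, (if t.card < K then ∏ q ∈ t, (-g q) else 0) := by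
        rw [mul_sum]
        apply sum_congr rfl
        intro d hd
        rw [hcard d hd, hprod _ d hd]
        simp
      have e2 : ∑ t ∈ S.powerset, (if (insert p t).card = K + 1 then ∏ q ∈ insert p t, (g q) else 0)
          = g p * ∑ t ∈ S.powerset, (if t.card = K then ∏ q ∈ t, (g q) else 0) := by
        rw [mul_sum]
        apply sum_congr rfl
        intro d hd
        rw [hcard d hd, hprod _ d hd]
        simp
      rw [e1, e2]
      generalize (∑ t ∈ S.powerset, (if t.card < K then ∏ q ∈ t, (-g q) else 0)) = T0 at *
      generalize (∑ t ∈ S.powerset, (if t.card < K+1 then ∏ q ∈ t, (-g q) else 0)) = T1 at *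
      generalize (∑ t ∈ S.powerset, (if t.card = K then ∏ q ∈ t, (g q) else 0)) = E0 at *
      generalize (∑ t ∈ S.powerset, (if t.card = K+1 then ∏ q ∈ t, (g q) else 0)) = E1 at *
      generalize (∏ q ∈ S, (1 - g q)) = P at *
      have e3 : (-1:ℝ)^(K+1) * ((1 - g p) * P - (T1 + -g p * T0)) =
        (-1:ℝ)^(K+1) * (P - T1) + g p * ((-1:ℝ)^K * (P - T0)) := by rw [pow_succ]; ring
      rw [e3]
      exact ⟨add_nonneg b.1 (mul_nonneg hg0 a.1), add_le_add b.2 (mul_le_mul_of_nonneg_left a.2 hg0)⟩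

open Finset in
lemma esymm_le {ι : Type*} [DecidableEq ι] (g : ι → ℝ) (S : Finset ι) (h0 : ∀ p ∈ S, 0 ≤ g p) (K : ℕ) :
    (∑ d ∈ S.powerset, if d.card = K then ∏ p ∈ d, g p else 0) ≤
      Real.exp (Real.exp 1 * (∑ p ∈ S, g p) - K) := by
  have h1 : Real.exp K * (∑ d ∈ S.powerset, if d.card = K then ∏ p ∈ d, g p else 0) ≤
      ∏ p ∈ S, (1 + Real.exp 1 * g p) := by
    rw [prod_one_add, mul_sum]
    apply sum_le_sum
    intro d hd
    rw [prod_mul_distrib, prod_const]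
    have : 0 ≤ ∏ p ∈ d, g p := prod_nonneg fun p hp => h0 p (mem_powerset.1 hd hp)
    split_ifs with h
    · rw [h, ← Real.exp_nat_mul, mul_one]
    · rw [mul_zero]; positivity
  have h2 : ∏ p ∈ S, (1 + Real.exp 1 * g p) ≤ Real.exp (Real.exp 1 * (∑ p ∈ S, g p)) := by
    rw [mul_sum, Real.exp_sum]
    apply prod_le_prod
    · intro p hp; have := h0 p hp; positivity
    · intro p hp; linarith [Real.add_one_le_exp (Real.exp 1 * g p)]
  rw [Real.exp_sub, le_div_iff₀ (Real.exp_pos _), mul_comm]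
  exact h1.trans h2

open Finset in
lemma count_ap (X M r : ℕ) (hM : 0 < M) :
    |(((range X).filter (fun n => n ≡ r [MOD M])).card : ℝ) - X / M| ≤ 1 := by
  have h := Nat.count_modEq_card X hM r
  rw [Nat.count_eq_card_filter_range] at h
  rw [h]
  have hM' : (0:ℝ) < M := by exact_mod_cast hM
  have e : (X:ℝ) = M * (X / M : ℕ) + (X % M : ℕ) := by exact_mod_cast (Nat.div_add_mod X M).symm
  have l : ((X % M : ℕ) : ℝ) < M := by exact_mod_cast Nat.mod_lt X hM
  have l0 : (0:ℝ) ≤ ((X % M : ℕ) : ℝ) := by positivity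
  have e2 : (X:ℝ) / M = (X / M : ℕ) + (X % M : ℕ) / M := by
    rw [div_eq_iff hM'.ne', add_mul, div_mul_cancel₀ _ hM'.ne', mul_comm]; exact e
  have l1 : ((X % M : ℕ) : ℝ) / M < 1 := by rw [div_lt_one hM']; exact l
  have l2 : 0 ≤ ((X % M : ℕ) : ℝ) / M := by positivity
  rw [e2, abs_le]
  push_cast
  split_ifs <;> constructor <;> push_cast <;> linarith

open Finset in
lemma count_sieve (X h : ℕ) (d : Finset ℕ) (hd : ∀ p ∈ d, p.Prime ∧ ¬ p ∣ h) (M r : ℕ) (hM : 0 < M)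
    (hc : ∀ p ∈ d, Nat.Coprime M p) :
    |(((range X).filter (fun n => n ≡ r [MOD M] ∧ ∀ p ∈ d, p ∣ n * (n + h))).card : ℝ)
      - X / M * ∏ p ∈ d, (2 / (p:ℝ))| ≤ 2 ^ d.card := by
  induction d using Finset.induction_on generalizing M r with
  | empty => simpa using count_ap X M r hM
  | insert p d hp ih =>
    obtain ⟨hpp, hph⟩ := hd p (mem_insert_self _ _)
    have hcp := hc p (mem_insert_self _ _)
    have hMp : 0 < M * p := Nat.mul_pos hM hpp.pos
    have hc' : ∀ q ∈ d, Nat.Coprime (M * p) q := by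
      intro q hq
      refine Nat.Coprime.mul_left (hc q (mem_insert_of_mem hq)) ?_
      rw [Nat.coprime_primes hpp (hd q (mem_insert_of_mem hq)).1]
      rintro rfl; exact hp hq
    have ih' := fun r => ih (fun q hq => hd q (mem_insert_of_mem hq)) (M * p) r hMp hc'
    obtain ⟨r0, h00, h01⟩ := Nat.chineseRemainder hcp r 0
    obtain ⟨r1, h10, h11⟩ := Nat.chineseRemainder hcp r ((p - 1) * h)
    have k0 : ∀ n, (n ≡ r0 [MOD M * p]) ↔ (n ≡ r [MOD M] ∧ p ∣ n) := by
      intro n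
      rw [← Nat.modEq_and_modEq_iff_modEq_mul hcp, ← Nat.modEq_zero_iff_dvd]
      exact ⟨fun H => ⟨H.1.trans h00, H.2.trans h01⟩, fun H => ⟨H.1.trans h00.symm, H.2.trans h01.symm⟩⟩
    have k1 : ∀ n, (n ≡ r1 [MOD M * p]) ↔ (n ≡ r [MOD M] ∧ p ∣ n + h) := by
      intro n
      have : p ∣ n + h ↔ n ≡ (p-1)*h [MOD p] := by
        rw [← Nat.modEq_zero_iff_dvd]
        have e : (p-1) * h + h ≡ 0 [MOD p] := by
          rw [Nat.modEq_zero_iff_dvd]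
          refine ⟨h, ?_⟩
          obtain ⟨q, rfl⟩ : ∃ q, p = q + 1 := ⟨p - 1, by have := hpp.pos; omega⟩
          simp; ring
        constructor
        · intro H; exact Nat.ModEq.add_right_cancel' h (H.trans e.symm)
        · intro H; exact (H.add_right h).trans e
      rw [← Nat.modEq_and_modEq_iff_modEq_mul hcp, this]
      exact ⟨fun H => ⟨H.1.trans h10, H.2.trans h11⟩, fun H => ⟨H.1.trans h10.symm, H.2.trans h11.symm⟩⟩
    have hset : (range X).filter (fun n => n ≡ r [MOD M] ∧ ∀ q ∈ insert p d, q ∣ n * (n + h)) =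
      (range X).filter (fun n => n ≡ r0 [MOD M * p] ∧ ∀ q ∈ d, q ∣ n * (n + h)) ∪
      (range X).filter (fun n => n ≡ r1 [MOD M * p] ∧ ∀ q ∈ d, q ∣ n * (n + h)) := by
      ext n
      simp only [mem_filter, mem_union, k0, k1, forall_mem_insert, hpp.dvd_mul]
      tauto
    have hdis : Disjoint ((range X).filter (fun n => n ≡ r0 [MOD M * p] ∧ ∀ q ∈ d, q ∣ n * (n + h)))
      ((range X).filter (fun n => n ≡ r1 [MOD M * p] ∧ ∀ q ∈ d, q ∣ n * (n + h))) := by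
      rw [disjoint_filter]
      intro n _ H1 H2
      have a := ((k0 n).1 H1.1).2
      have b := ((k1 n).1 H2.1).2
      exact hph ((Nat.dvd_add_right a).1 b)
    rw [hset, card_union_of_disjoint hdis, prod_insert hp, card_insert_of_notMem hp, pow_succ]
    have a := abs_le.1 (ih' r0)
    have b := abs_le.1 (ih' r1)
    have hp0 : (p:ℝ) ≠ 0 := by exact_mod_cast hpp.ne_zero
    have hM0 : (M:ℝ) ≠ 0 := by exact_mod_cast hM.ne'
    have e : (X:ℝ) / M * (2 / p * ∏ q ∈ d, (2 / (q:ℝ))) = 2 * (X / (M * p : ℕ) * ∏ q ∈ d, (2 / (q:ℝ))) := by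
      push_cast; field_simp
    rw [e, abs_le]
    push_cast at *
    constructor <;> linarith [a.1, a.2, b.1, b.2]

open Finset in
lemma err_le (S : Finset ℕ) (z K : ℕ) (hz : 1 ≤ z) (hS : S.card ≤ z) :
    (∑ d ∈ S.powerset, if d.card < K then (2:ℝ) ^ d.card else 0) ≤ (2 * z) ^ K := by
  have h := sum_powerset_apply_card (fun j => if j < K then (2:ℝ) ^ j else 0) (x := S)
  rw [h]
  have g : ∀ K : ℕ, ∑ j ∈ range K, ((2:ℝ) * z) ^ j ≤ (2 * z) ^ K := by
    intro K
    have hz' : (1:ℝ) ≤ z := by exact_mod_cast hz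
    induction K with
    | zero => simp
    | succ K ih =>
      rw [sum_range_succ, pow_succ]
      have : 0 ≤ ((2:ℝ) * z) ^ K := by positivity
      nlinarith
  refine le_trans ?_ (g K)
  have : ∀ j ∈ range (S.card + 1), S.card.choose j • (if j < K then (2:ℝ) ^ j else 0) ≤
      if j ∈ range K then ((2:ℝ) * z) ^ j else 0 := by
    intro j _
    simp only [mem_range]
    split_ifs
    · rw [nsmul_eq_mul, mul_pow, mul_comm]
      gcongr
      have : S.card.choose j ≤ z ^ j := (Nat.choose_le_pow _ _).trans (Nat.pow_le_pow_left hS j)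
      exact_mod_cast this
    · simp
  refine (sum_le_sum this).trans ?_
  rw [← sum_filter]
  apply sum_le_sum_of_subset_of_nonneg
  · intro j hj; exact (mem_filter.1 hj).2
  · intros; positivity

open Finset in
lemma sieve_upper (X h z K : ℕ) (hK : Odd K) (hz : 1 ≤ z) (S : Finset ℕ) (hS : S.card ≤ z)
    (hSp : ∀ p ∈ S, p.Prime ∧ ¬ p ∣ h) :
    (((range X).filter (fun n => ∀ p ∈ S, ¬ p ∣ n * (n + h))).card : ℝ) ≤
     X * (∏ p ∈ S, (1 - 2 / (p:ℝ)) + Real.exp (Real.exp 1 * (∑ p ∈ S, 2 / (p:ℝ)) - K)) + (2 * z) ^ K := by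
  classical
  let g : ℕ → ℕ → ℝ := fun n p => if p ∣ n * (n + h) then 1 else 0
  have hg0 : ∀ n p, 0 ≤ g n p := by intro n p; simp only [g]; split_ifs <;> norm_num
  have hg1 : ∀ n p, g n p ≤ 1 := by intro n p; simp only [g]; split_ifs <;> norm_num
  have hK' : (-1:ℝ)^K = -1 := hK.neg_one_pow
  have c1 : (((range X).filter (fun n => ∀ p ∈ S, ¬ p ∣ n * (n + h))).card : ℝ) =
      ∑ n ∈ range X, ∏ p ∈ S, (1 - g n p) := by
    rw [card_filter, Nat.cast_sum]
    apply sum_congr rfl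
    intro n _
    split_ifs with H
    · rw [prod_eq_one]; · simp
      intro p hp; simp [g, H p hp]
    · push Not at H
      obtain ⟨p, hp, hpd⟩ := H
      rw [prod_eq_zero hp]; · simp
      simp [g, hpd]
  have c2 : ∑ n ∈ range X, ∏ p ∈ S, (1 - g n p) ≤
      ∑ n ∈ range X, ∑ d ∈ S.powerset, if d.card < K then ∏ p ∈ d, (-g n p) else 0 := by
    apply sum_le_sum
    intro n _
    have := (bonf (g n) S (fun p _ => hg0 n p) (fun p _ => hg1 n p) K).1
    rw [hK'] at this
    linarith
  rw [sum_comm] at c2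
  have c3 : ∀ d ∈ S.powerset, (∑ n ∈ range X, if d.card < K then ∏ p ∈ d, (-g n p) else 0) ≤
     X * (if d.card < K then ∏ p ∈ d, (-(2/(p:ℝ))) else 0) + (if d.card < K then (2:ℝ) ^ d.card else 0) := by
    intro d hd
    split_ifs
    swap
    · simp
    have e1 : ∑ n ∈ range X, ∏ p ∈ d, (-g n p) = (-1)^d.card *
        (((range X).filter (fun n => n ≡ 0 [MOD 1] ∧ ∀ p ∈ d, p ∣ n * (n + h))).card : ℝ) := by
      rw [card_filter, Nat.cast_sum, mul_sum]
      apply sum_congr rfl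
      intro n _
      rw [prod_neg]
      congr 1
      split_ifs with H
      · rw [prod_eq_one]; · simp
        intro p hp; simp [g, H.2 p hp]
      · have : ¬ ∀ p ∈ d, p ∣ n * (n + h) := fun H' => H ⟨Nat.modEq_one, H'⟩
        push Not at this
        obtain ⟨p, hp, hpd⟩ := this
        rw [prod_eq_zero hp]; · simp
        simp [g, hpd]
    have e2 := count_sieve X h d (fun p hp => hSp p (mem_powerset.1 hd hp)) 1 0 one_pos
      (fun p _ => Nat.coprime_one_left p)
    rw [e1, prod_neg]
    rw [abs_le] at e2
    simp only [Nat.cast_one, div_one] at e2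
    rcases neg_one_pow_eq_or ℝ d.card with H | H <;> rw [H] <;> linarith [e2.1, e2.2]
  have c4 := sum_le_sum c3
  rw [sum_add_distrib, ← mul_sum] at c4
  have c5 := err_le S z K hz hS
  have hp0 : ∀ p ∈ S, (0:ℝ) ≤ 2 / (p:ℝ) := fun p _ => by positivity
  have c6 := (bonf (fun p : ℕ => 2 / (p:ℝ)) S hp0
    (fun p hp => by
      have := (hSp p hp).1.two_le
      have h2 : (2:ℝ) ≤ p := by exact_mod_cast this
      rw [div_le_one (by linarith)]; exact h2) K).2
  have c7 := esymm_le (fun p : ℕ => 2 / (p:ℝ)) S hp0 K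
  rw [hK'] at c6
  have c8 : (∑ d ∈ S.powerset, if d.card < K then ∏ p ∈ d, (-(2/(p:ℝ))) else 0) ≤
    ∏ p ∈ S, (1 - 2 / (p:ℝ)) + Real.exp (Real.exp 1 * (∑ p ∈ S, 2 / (p:ℝ)) - K) := by linarith
  have c9 := mul_le_mul_of_nonneg_left c8 (Nat.cast_nonneg (α := ℝ) X)
  rw [c1]
  linarith

open Finset in
lemma prod_ge (s : Finset ℕ) (hs : ∀ p ∈ s, 2 ≤ p) :
    1 / ((s.card : ℝ) + 1) ≤ ∏ p ∈ s, (1 - 1 / (p:ℝ)) := by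
  induction s using Finset.induction_on_max with
  | empty => simp
  | insert a s ha ih =>
    have hn : a ∉ s := fun h => lt_irrefl _ (ha a h)
    rw [prod_insert hn, card_insert_of_notMem hn]
    have ih' := ih (fun p hp => hs p (mem_insert_of_mem hp))
    have hc : s.card + 2 ≤ a := by
      have : s ⊆ Ico 2 a := fun p hp => mem_Ico.2 ⟨hs p (mem_insert_of_mem hp), ha p hp⟩
      have := card_le_card this
      rw [Nat.card_Ico] at this
      have := hs a (mem_insert_self _ _)
      omega
    have hc' : (s.card : ℝ) + 2 ≤ a := by exact_mod_cast hc
    have c0 : (0:ℝ) ≤ s.card := by positivity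
    have : 1 - 1 / ((s.card:ℝ) + 2) ≤ 1 - 1 / (a:ℝ) := by
      gcongr
    have e : 1 / (((s.card + 1 : ℕ):ℝ) + 1) = (1 - 1 / ((s.card:ℝ) + 2)) * (1 / ((s.card:ℝ) + 1)) := by
      push_cast; field_simp; ring
    rw [e]
    apply mul_le_mul this ih' (by positivity)
    refine le_trans ?_ this
    rw [sub_nonneg, div_le_one (by positivity)]; linarith

lemma card_pf_le (h : ℕ) (hh : h ≠ 0) : h.primeFactors.card ≤ Nat.log 2 h := by
  apply Nat.le_log_of_pow_le (by norm_num)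
  refine le_trans ?_ (Nat.le_of_dvd (Nat.pos_of_ne_zero hh) (Nat.prod_primeFactors_dvd h))
  apply Finset.pow_card_le_prod
  intro p hp
  exact (Nat.prime_of_mem_primeFactors hp).two_le

open Finset in
lemma euler_le (z : ℕ) (hz : 2 ≤ z) : ∏ p ∈ z.primesBelow, (1 - 1 / (p:ℝ)) ≤ 1 / Real.log z := by
  let f : ℕ →* ℝ :=
    { toFun := fun n => ((n:ℝ))⁻¹
      map_one' := by simp
      map_mul' := by intro a b; push_cast; rw [mul_inv] }
  have hf : ∀ {p : ℕ}, p.Prime → ‖f p‖ < 1 := by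
    intro p hp
    have : (1:ℝ) < p := by exact_mod_cast hp.one_lt
    change ‖((p:ℝ))⁻¹‖ < 1
    rw [Real.norm_of_nonneg (by positivity)]
    exact inv_lt_one_of_one_lt₀ this
  obtain ⟨h1, h2⟩ := EulerProduct.summable_and_hasSum_smoothNumbers_prod_primesBelow_geometric (f := f) hf z
  have hlog : Real.log z ≤ ∏ p ∈ z.primesBelow, (1 - f p)⁻¹ := by
    have a : Real.log z ≤ ∑ n ∈ Ico 1 z, ((n:ℝ))⁻¹ := by
      have := log_add_one_le_harmonic (z - 1)
      rw [Nat.sub_add_cancel (by omega)] at this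
      refine this.trans (le_of_eq ?_)
      rw [harmonic_eq_sum_Icc]
      push_cast
      congr 1
    refine a.trans ?_
    let e : {n // n ∈ Ico 1 z} ↪ z.smoothNumbers :=
      ⟨fun n => ⟨n.1, Nat.mem_smoothNumbers_of_lt (mem_Ico.1 n.2).1 (mem_Ico.1 n.2).2⟩,
        fun a b hab => Subtype.ext (congrArg (fun t : z.smoothNumbers => t.1) hab)⟩
    let F : Finset z.smoothNumbers := (Ico 1 z).attach.map e
    have b := sum_le_hasSum F (fun i _ => by change 0 ≤ ((i.1:ℕ):ℝ)⁻¹; positivity) h2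
    refine le_trans (le_of_eq ?_) b
    rw [sum_map]
    exact (sum_attach (Ico 1 z) (fun n => ((n:ℝ))⁻¹)).symm
  have hz' : 0 < Real.log z := Real.log_pos (by exact_mod_cast hz)
  rw [prod_inv_distrib] at hlog
  rw [one_div]
  have : (∏ p ∈ z.primesBelow, (1 - f p)) = ∏ p ∈ z.primesBelow, (1 - 1 / (p:ℝ)) := by
    apply prod_congr rfl; intro p _; rw [one_div]; rfl
  rw [this] at hlog
  rw [← inv_inv (∏ p ∈ z.primesBelow, (1 - 1 / (p:ℝ)))]
  exact inv_anti₀ hz' hlog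

open Finset in
lemma pair_count (X h z K : ℕ) (hK : Odd K) (hz : 2 ≤ z) (hh : h ≠ 0) :
    (((range X).filter (fun n => n.Prime ∧ (n + h).Prime)).card : ℝ) ≤
     z + X * (((Nat.log 2 h + 1) / Real.log z) ^ 2 +
       Real.exp (2 * Real.exp 1 * (∑ p ∈ z.primesBelow, 1 / (p:ℝ)) - K)) + (2 * z) ^ K := by
  set S := z.primesBelow.filter (fun p => ¬ p ∣ h) with hSdef
  have hSz : S.card ≤ z := by
    refine (card_filter_le _ _).trans ?_
    rw [Nat.primesBelow]
    refine (card_filter_le _ _).trans ?_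
    simp
  have hSp : ∀ p ∈ S, p.Prime ∧ ¬ p ∣ h := fun p hp =>
    ⟨Nat.prime_of_mem_primesBelow (mem_filter.1 hp).1, (mem_filter.1 hp).2⟩
  have main := sieve_upper X h z K hK (by omega) S hSz hSp
  have hsub : (range X).filter (fun n => n.Prime ∧ (n + h).Prime) ⊆
      range z ∪ (range X).filter (fun n => ∀ p ∈ S, ¬ p ∣ n * (n + h)) := by
    intro n hn
    rw [mem_filter] at hn
    rw [mem_union, mem_range, mem_filter]
    by_cases hnz : n < z
    · left; exact hnz
    · right
      refine ⟨hn.1, fun p hp hpd => ?_⟩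
      have hpz := Nat.lt_of_mem_primesBelow (mem_filter.1 hp).1
      have hpp := (hSp p hp).1
      rcases hpp.dvd_mul.1 hpd with H | H
      · have := (Nat.prime_dvd_prime_iff_eq hpp hn.2.1).1 H; omega
      · have := (Nat.prime_dvd_prime_iff_eq hpp hn.2.2).1 H; omega
  have hcard := (card_le_card hsub).trans (card_union_le _ _)
  rw [card_range] at hcard
  have hcard' : (((range X).filter (fun n => n.Prime ∧ (n + h).Prime)).card : ℝ) ≤
    z + (((range X).filter (fun n => ∀ p ∈ S, ¬ p ∣ n * (n + h))).card : ℝ) := by exact_mod_cast hcard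
  have hfac : ∀ p ∈ z.primesBelow, (0:ℝ) ≤ 1 - 1 / (p:ℝ) := by
    intro p hp
    have : (1:ℝ) ≤ p := by exact_mod_cast (Nat.prime_of_mem_primesBelow hp).one_lt.le
    rw [sub_nonneg, div_le_one (by linarith)]; exact this
  have hP1 : ∏ p ∈ S, (1 - 2 / (p:ℝ)) ≤ (∏ p ∈ S, (1 - 1 / (p:ℝ))) ^ 2 := by
    rw [← prod_pow]
    apply prod_le_prod
    · intro p hp
      have : (2:ℝ) ≤ p := by exact_mod_cast (hSp p hp).1.two_le
      rw [sub_nonneg, div_le_one (by linarith)]; exact this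
    · intro p hp
      have : (1 - 1 / (p:ℝ))^2 = 1 - 2 / p + (1/(p:ℝ))^2 := by ring
      rw [this]; linarith [sq_nonneg (1/(p:ℝ))]
  have hP2 : ∏ p ∈ S, (1 - 1 / (p:ℝ)) ≤ (Nat.log 2 h + 1) / Real.log z := by
    have hsplit := prod_filter_not_mul_prod_filter z.primesBelow (fun p => p ∣ h) (fun p => (1 - 1 / (p:ℝ)))
    have he := euler_le z hz
    rw [← hsplit] at he
    have hl := prod_ge (z.primesBelow.filter (fun p => p ∣ h))
      (fun p hp => (Nat.prime_of_mem_primesBelow (mem_filter.1 hp).1).two_le)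
    have hc : (z.primesBelow.filter (fun p => p ∣ h)).card ≤ Nat.log 2 h := by
      refine le_trans (card_le_card ?_) (card_pf_le h hh)
      intro p hp
      rw [mem_filter] at hp
      exact Nat.mem_primeFactors.2 ⟨Nat.prime_of_mem_primesBelow hp.1, hp.2, hh⟩
    have hc' : ((z.primesBelow.filter (fun p => p ∣ h)).card : ℝ) ≤ Nat.log 2 h := by exact_mod_cast hc
    have hl2 : 1 / ((Nat.log 2 h : ℝ) + 1) ≤ ∏ p ∈ z.primesBelow.filter (fun p => p ∣ h), (1 - 1 / (p:ℝ)) := by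
      refine le_trans ?_ hl
      gcongr
    have hS0 : 0 ≤ ∏ p ∈ S, (1 - 1 / (p:ℝ)) := prod_nonneg fun p hp => hfac p (mem_filter.1 hp).1
    have := (mul_le_mul_of_nonneg_left hl2 hS0).trans he
    rw [mul_one_div, div_le_iff₀ (by positivity)] at this
    rw [div_eq_mul_one_div, mul_comm]; exact this
  have hP3 : (∏ p ∈ S, (1 - 1 / (p:ℝ))) ^ 2 ≤ ((Nat.log 2 h + 1) / Real.log z) ^ 2 := by
    apply pow_le_pow_left₀ _ hP2
    exact prod_nonneg fun p hp => hfac p (mem_filter.1 hp).1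
  have hE : Real.exp (Real.exp 1 * (∑ p ∈ S, 2 / (p:ℝ)) - K) ≤
     Real.exp (2 * Real.exp 1 * (∑ p ∈ z.primesBelow, 1 / (p:ℝ)) - K) := by
    apply Real.exp_le_exp.2
    have : ∑ p ∈ S, 2 / (p:ℝ) ≤ 2 * ∑ p ∈ z.primesBelow, 1 / (p:ℝ) := by
      rw [mul_sum]
      simp_rw [mul_one_div]
      apply sum_le_sum_of_subset_of_nonneg (filter_subset _ _)
      intros; positivity
    nlinarith [Real.exp_pos 1]
  have := mul_le_mul_of_nonneg_left (add_le_add (hP1.trans hP3) hE) (Nat.cast_nonneg (α := ℝ) X)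
  linarith

open Finset in
lemma log_fact (N : ℕ) : Real.log (N.factorial) =
    ∑ p ∈ (N+1).primesBelow, ((N.factorial).factorization p : ℝ) * Real.log p := by
  rw [Real.log_nat_eq_sum_factorization, Finsupp.sum]
  apply sum_subset
  · intro p hp
    rw [Nat.support_factorization, Nat.mem_primeFactors] at hp
    rw [Nat.mem_primesBelow]
    exact ⟨by have := (hp.1.dvd_factorial).1 hp.2.1; omega, hp.1⟩
  · intro p _ hp
    rw [Finsupp.notMem_support_iff] at hp
    rw [hp]; simp

lemma log_fact_ge (N : ℕ) : N * Real.log N - N ≤ Real.log (N.factorial) := by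
  rcases Nat.eq_zero_or_pos N with rfl | hN
  · simp
  have := Stirling.le_log_factorial_stirling hN.ne'
  have h1 : (1:ℝ) ≤ N := by exact_mod_cast hN
  have a := Real.log_nonneg h1
  have b : 0 ≤ Real.log (2 * Real.pi) := Real.log_nonneg (by linarith [Real.pi_gt_three])
  linarith

open Finset in
lemma mertens_ge (N : ℕ) (hN : 1 ≤ N) :
    Real.log N - 1 ≤ ∑ p ∈ (N+1).primesBelow, Real.log p / ((p:ℝ) - 1) := by
  have hN' : (0:ℝ) < N := by exact_mod_cast hN
  have h : Real.log (N.factorial) ≤ N * ∑ p ∈ (N+1).primesBelow, Real.log p / ((p:ℝ) - 1) := by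
    rw [log_fact, mul_sum]
    apply sum_le_sum
    intro p hp
    have hpp := Nat.prime_of_mem_primesBelow hp
    have := Fact.mk hpp
    have h2 : (2:ℝ) ≤ p := by exact_mod_cast hpp.two_le
    have hl : 0 ≤ Real.log p := Real.log_nonneg (by linarith)
    have := sub_one_mul_padicValNat_factorial (p := p) N
    have h3 : (p - 1) * padicValNat p N.factorial ≤ N := by rw [this]; exact Nat.sub_le _ _
    rw [Nat.factorization_def _ hpp]
    have h4 : ((p:ℝ) - 1) * padicValNat p N.factorial ≤ N := by
      have : ((p - 1 : ℕ) : ℝ) = p - 1 := by push_cast [hpp.one_lt.le]; ring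
      rw [← this]; exact_mod_cast h3
    have h5 : (padicValNat p N.factorial : ℝ) ≤ N / ((p:ℝ) - 1) := by
      rw [le_div_iff₀ (by linarith)]; linarith
    calc _ ≤ N / ((p:ℝ) - 1) * Real.log p := mul_le_mul_of_nonneg_right h5 hl
      _ = _ := by ring
  have := log_fact_ge N
  have : N * (Real.log N - 1) ≤ N * ∑ p ∈ (N+1).primesBelow, Real.log p / ((p:ℝ) - 1) := by linarith
  exact le_of_mul_le_mul_left this hN'

open Finset in
lemma mertens_le (N : ℕ) (hN : 1 ≤ N) :
    ∑ p ∈ (N+1).primesBelow, Real.log p / (p:ℝ) ≤ Real.log N + Real.log 4 := by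
  have hN' : (0:ℝ) < N := by exact_mod_cast hN
  have h : ∀ p ∈ (N+1).primesBelow, N * (Real.log p / (p:ℝ)) ≤
      ((N.factorial).factorization p : ℝ) * Real.log p + Real.log p := by
    intro p hp
    have hpp := Nat.prime_of_mem_primesBelow hp
    have h2 : (2:ℝ) ≤ p := by exact_mod_cast hpp.two_le
    have hl : 0 ≤ Real.log p := Real.log_nonneg (by linarith)
    have h3 : N / p ≤ (N.factorial).factorization p := by
      have := Fact.mk hpp
      rw [Nat.factorization_def _ hpp, ← padicValNat_mul_div_factorial, padicValNat_factorial_mul]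
      exact Nat.le_add_left _ _
    have h4 : (N:ℝ) / p ≤ (N.factorial).factorization p + 1 := by
      have h5 : (N:ℝ) / p < (N / p : ℕ) + 1 := by
        rw [div_lt_iff₀ (by linarith)]
        exact_mod_cast Nat.lt_mul_of_div_lt (Nat.lt_succ_self (N / p)) hpp.pos
      have : ((N / p : ℕ) : ℝ) ≤ (N.factorial).factorization p := by exact_mod_cast h3
      linarith
    calc _ = (N:ℝ) / p * Real.log p := by ring
      _ ≤ _ := mul_le_mul_of_nonneg_right h4 hl
      _ = _ := by ring
  have h2 := sum_le_sum h
  rw [← mul_sum, sum_add_distrib, ← log_fact] at h2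
  have h3 : ∑ p ∈ (N+1).primesBelow, Real.log p ≤ Real.log 4 * N := by
    have := Chebyshev.theta_le_log4_mul_x hN'.le
    rw [Chebyshev.theta_eq_sum_primesLE_log] at this
    exact this
  have h4 : Real.log N.factorial ≤ N * Real.log N := by
    rw [← Real.log_pow]
    apply Real.log_le_log (by exact_mod_cast Nat.factorial_pos N)
    exact_mod_cast Nat.factorial_le_pow N
  have : N * ∑ p ∈ (N+1).primesBelow, Real.log p / (p:ℝ) ≤ N * (Real.log N + Real.log 4) := by linarith
  exact le_of_mul_le_mul_left this hN'

open Finset in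
lemma recip_le (z : ℕ) (hz : 4 ≤ Real.log z) :
    ∑ p ∈ z.primesBelow, 1 / (p:ℝ) ≤ 3 * √(Real.log z) := by
  set y := √(Real.log z) with hy
  have hy2 : 2 ≤ y := Real.le_sqrt_of_sq_le (by linarith)
  have hyy : y * y = Real.log z := Real.mul_self_sqrt (by linarith)
  have hz1 : 1 ≤ z := by
    rcases Nat.eq_zero_or_pos z with rfl | h
    · simp at hz; linarith
    · exact h
  have hm := mertens_le z hz1
  have hsub : z.primesBelow ⊆ (z+1).primesBelow := by
    intro p hp; rw [Nat.mem_primesBelow] at *; exact ⟨by omega, hp.2⟩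
  have hm2 : ∑ p ∈ z.primesBelow, Real.log p / (p:ℝ) ≤ Real.log z + Real.log 4 := by
    refine le_trans (sum_le_sum_of_subset_of_nonneg hsub ?_) hm
    intro p _ _
    exact div_nonneg (Real.log_natCast_nonneg p) (by positivity)
  have h4 : Real.log 4 ≤ 2 := by
    have : (4:ℝ) = 2^2 := by norm_num
    rw [this, Real.log_pow]; have := Real.log_two_lt_d9; push_cast; linarith
  have key : ∀ p ∈ z.primesBelow, 1 / (p:ℝ) ≤ (if p ∈ Icc 1 ⌊Real.exp y⌋₊ then (p:ℝ)⁻¹ else 0) +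
      (1 / y) * (Real.log p / p) := by
    intro p hp
    have hpp := Nat.prime_of_mem_primesBelow hp
    have hp0 : (0:ℝ) < p := by exact_mod_cast hpp.pos
    have hnn : 0 ≤ (1 / y) * (Real.log p / p) := 
      mul_nonneg (by positivity) (div_nonneg (Real.log_natCast_nonneg p) (by positivity))
    split_ifs with H
    · rw [one_div]; linarith
    · have : y ≤ Real.log p := by
        by_contra hc
        push Not at hc
        apply H
        rw [mem_Icc]
        refine ⟨hpp.pos, Nat.le_floor ?_⟩
        rw [← Real.log_le_iff_le_exp hp0]; exact hc.le
      have : 1 ≤ 1 / y * Real.log p := by rw [one_div_mul_eq_div, le_div_iff₀ (by linarith)]; linarith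
      rw [zero_add, ← mul_div_assoc]
      gcongr
  have h5 := sum_le_sum key
  rw [sum_add_distrib, ← mul_sum] at h5
  have h6 : ∑ p ∈ z.primesBelow, (if p ∈ Icc 1 ⌊Real.exp y⌋₊ then (p:ℝ)⁻¹ else 0) ≤ 1 + y := by
    rw [← sum_filter]
    have : ∑ p ∈ Icc 1 ⌊Real.exp y⌋₊, (p:ℝ)⁻¹ ≤ 1 + y := by
      have := harmonic_floor_le_one_add_log (Real.exp y) (Real.one_le_exp (by linarith))
      rw [Real.log_exp, harmonic_eq_sum_Icc] at this
      push_cast at this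
      exact this
    refine le_trans (sum_le_sum_of_subset_of_nonneg ?_ ?_) this
    · intro p hp; exact (mem_filter.1 hp).2
    · intros; positivity
  have h7 : 1 / y * ∑ p ∈ z.primesBelow, Real.log p / (p:ℝ) ≤ y + 1 := by
    rw [one_div_mul_eq_div, div_le_iff₀ (by linarith)]
    nlinarith
  linarith

open Finset in
lemma sum_primes (M : ℕ) (f : ℕ → ℝ) : ∑ p ∈ (Nat.nth Nat.Prime M + 1).primesBelow, f p =
    ∑ k ∈ range (M+1), f (Nat.nth Nat.Prime k) := by
  have hm : StrictMono (Nat.nth Nat.Prime) := Nat.nth_strictMono Nat.infinite_setOfPred_prime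
  have : (Nat.nth Nat.Prime M + 1).primesBelow = (range (M+1)).image (Nat.nth Nat.Prime) := by
    ext p
    simp only [Nat.mem_primesBelow, mem_image, mem_range]
    constructor
    · rintro ⟨h1, h2⟩
      refine ⟨Nat.count Nat.Prime p, ?_, Nat.nth_count h2⟩
      rw [← hm.lt_iff_lt, Nat.nth_count h2]
      have := hm (Nat.lt_succ_self M)
      simp only [Nat.succ_eq_add_one] at this
      omega
    · rintro ⟨k, hk, rfl⟩
      refine ⟨?_, Nat.prime_nth_prime k⟩
      have := hm.monotone (Nat.lt_succ_iff.1 hk)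
      omega
  rw [this, sum_image]
  intro a _ b _ h
  exact hm.injective h

open Finset in
lemma freq_small : ∃ᶠ k in Filter.atTop,
    (Nat.nth Nat.Prime k : ℝ) < (k + 1) * Real.log (Nat.nth Nat.Prime k) := by
  intro hev
  simp only [not_lt] at hev
  rw [Filter.eventually_atTop] at hev
  obtain ⟨N0, hN0⟩ := hev
  set P : ℕ → ℝ := fun k => (Nat.nth Nat.Prime k : ℝ) with hP
  have hPk : ∀ k : ℕ, (k:ℝ) + 2 ≤ P k := fun k => by
    have := Nat.add_two_le_nth_prime k
    simp only [hP]; exact_mod_cast this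
  have hl0 : ∀ k, 0 ≤ Real.log (P k) := fun k => Real.log_natCast_nonneg _
  set C0 := ∑ k ∈ range N0, Real.log (P k) / (P k - 1) with hC0
  have sq : ∀ M : ℕ, ∑ k ∈ range (M+1), 1 / ((k:ℝ) + 1)^2 ≤ 2 - 1 / ((M:ℝ) + 1) := by
    intro M
    induction M with
    | zero => norm_num
    | succ M ih =>
      rw [sum_range_succ]
      push_cast
      have h1 : 1 / ((M:ℝ)+1) - 1 / ((M:ℝ) + 1 + 1) = 1 / (((M:ℝ)+1)*((M:ℝ)+1+1)) := by field_simp; ring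
      have h2 : 1 / ((M:ℝ) + 1 + 1)^2 ≤ 1 / (((M:ℝ)+1)*((M:ℝ)+1+1)) := by
        apply one_div_le_one_div_of_le (by positivity)
        nlinarith [Nat.cast_nonneg (α := ℝ) M]
      linarith
  have key : ∀ M, Real.log (P M) - 1 ≤ C0 + (1 + Real.log (M+1)) + 2 := by
    intro M
    have h1 := mertens_ge (Nat.nth Nat.Prime M) (Nat.prime_nth_prime M).one_lt.le
    rw [sum_primes M (fun p => Real.log p / ((p:ℝ) - 1))] at h1
    have h2 : ∀ k ∈ range (M+1), Real.log (P k) / (P k - 1) ≤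
      (if k ∈ range N0 then Real.log (P k) / (P k - 1) else 0) + (((k:ℝ)+1)⁻¹ + 1/((k:ℝ)+1)^2) := by
      intro k _
      have := hPk k
      have k0 : (0:ℝ) ≤ k := by positivity
      have e0 : 0 ≤ ((k:ℝ)+1)⁻¹ + 1/((k:ℝ)+1)^2 := by positivity
      split_ifs with H
      · linarith
      · rw [zero_add]
        have h3 := hN0 k (by simpa using H)
        have h4 : Real.log (P k) ≤ P k / (k+1) := by
          rw [le_div_iff₀ (by positivity)]; linarith
        have h5 : ((k:ℝ)+1)⁻¹ + 1/((k:ℝ)+1)^2 = (k+2)/(k+1) * (1/(k+1)) := by field_simp; ring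
        have h6 : P k / (P k - 1) ≤ (k+2)/(k+1) := by
          rw [div_le_div_iff₀ (by linarith) (by positivity)]; nlinarith
        rw [h5]
        calc _ ≤ P k / (k+1) / (P k - 1) := by
              apply div_le_div_of_nonneg_right h4; linarith
          _ = P k / (P k - 1) * (1/(k+1)) := by field_simp
          _ ≤ _ := by gcongr
    have h3 := sum_le_sum h2
    rw [sum_add_distrib, sum_add_distrib] at h3
    have h4 : ∑ k ∈ range (M+1), (if k ∈ range N0 then Real.log (P k) / (P k - 1) else 0) ≤ C0 := by
      rw [← sum_filter]
      apply sum_le_sum_of_subset_of_nonneg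
      · intro k hk; exact (mem_filter.1 hk).2
      · intro k _ _
        exact div_nonneg (hl0 k) (by linarith [hPk k, Nat.cast_nonneg (α := ℝ) k])
    have h5 : ∑ k ∈ range (M+1), ((k:ℝ)+1)⁻¹ ≤ 1 + Real.log (M+1) := by
      have := harmonic_le_one_add_log (M+1)
      rw [harmonic] at this
      push_cast at this
      exact this
    have h6 : ∑ k ∈ range (M+1), 1/((k:ℝ)+1)^2 ≤ 2 := by
      have := sq M
      have : 0 ≤ 1 / ((M:ℝ)+1) := by positivity
      linarith
    linarith
  have key2 : ∀ M ≥ N0, Real.log (Real.log (P M)) ≤ C0 + 4 := by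
    intro M hM
    have h1 := key M
    have h2 := hN0 M hM
    have h3 := hPk M
    have k0 : (0:ℝ) ≤ M := by positivity
    have hlp : 0 < Real.log (P M) := Real.log_pos (by linarith)
    have h4 : Real.log ((M+1) * Real.log (P M)) ≤ Real.log (P M) :=
      Real.log_le_log (by positivity) h2
    rw [Real.log_mul (by positivity) hlp.ne'] at h4
    linarith
  have ht : Filter.Tendsto (fun M : ℕ => Real.log (Real.log (P M))) Filter.atTop Filter.atTop := by
    refine Real.tendsto_log_atTop.comp (Real.tendsto_log_atTop.comp ?_)
    apply Filter.tendsto_atTop_mono (f := fun M : ℕ => (M:ℝ)) _ tendsto_natCast_atTop_atTop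
    intro k; linarith [hPk k]
  obtain ⟨M, h1, h2⟩ := ((ht.eventually_gt_atTop (C0+4)).and (Filter.eventually_ge_atTop N0)).exists
  linarith [key2 M h2]

lemma two_exp_le : Real.exp 1 ≤ 3 := by have := Real.exp_one_lt_d9; linarith

open Finset in
lemma pair_bound : ∀ᶠ u : ℝ in Filter.atTop, ∀ X : ℕ, Real.log X = u ^ 20 → ∀ h : ℕ, h ≠ 0 →
    (h:ℝ) ≤ 2 * u^20 → (((range X).filter (fun n => n.Prime ∧ (n + h).Prime)).card : ℝ) ≤
      2 * X / u^22 := by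
  have a1 : ∀ᶠ u : ℝ in Filter.atTop, 20 * Real.log u ≤ (u - 2) * Real.log 2 := by
    have := Real.isLittleO_log_id_atTop.bound (c := Real.log 2 / 40) (by positivity)
    filter_upwards [this, Filter.eventually_ge_atTop 4] with u hu hu4
    simp only [id, Real.norm_eq_abs] at hu
    rw [abs_of_nonneg (by linarith : (0:ℝ) ≤ u)] at hu
    have := (le_abs_self _).trans hu
    have l2 : 0 < Real.log 2 := Real.log_pos (by norm_num)
    nlinarith
  have a2 : ∀ᶠ u : ℝ in Filter.atTop, 3 * u^22 ≤ Real.exp u := by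
    have := (Real.isLittleO_pow_exp_atTop (n := 22)).bound (c := 1/3) (by norm_num)
    filter_upwards [this] with u hu
    simp only [Real.norm_eq_abs, Real.abs_exp] at hu
    have := (le_abs_self _).trans hu
    linarith
  filter_upwards [a1, a2, Filter.eventually_ge_atTop 13] with u h1 h2 hu X hX h hh hhu
  have hX0 : (0:ℝ) < X := by
    rcases Nat.eq_zero_or_pos X with rfl | H
    · simp at hX; exact absurd hX (by positivity)
    · exact_mod_cast H
  have hXe : (X:ℝ) = Real.exp (u^20) := by rw [← hX, Real.exp_log hX0]
  have u6 : 1 ≤ u^6 := one_le_pow₀ (by linarith)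
  have u12 : 4 ≤ u^12 := by
    calc (4:ℝ) ≤ 13^12 := by norm_num
      _ ≤ u^12 := by gcongr
  have e12 : u^12 = u^6 * u^6 := by ring
  set z := ⌈Real.exp (u^12)⌉₊ with hz
  have hz1 : Real.exp (u^12) ≤ z := Nat.le_ceil _
  have hez : 1 + u^12 ≤ Real.exp (u^12) := by linarith [Real.add_one_le_exp (u^12)]
  have hz2 : (z:ℝ) ≤ 2 * Real.exp (u^12) := by
    have := Nat.ceil_lt_add_one (Real.exp_pos (u^12)).le
    linarith
  have hzp : (0:ℝ) < z := by linarith [Real.exp_pos (u^12)]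
  have hlz1 : u^12 ≤ Real.log z := (Real.le_log_iff_exp_le hzp).2 hz1
  have l2 : Real.log 2 ≤ 1 := by linarith [Real.log_two_lt_d9]
  have l20 : 0 < Real.log 2 := Real.log_pos (by norm_num)
  have hlz2 : Real.log z ≤ u^12 + 1 := by
    have := Real.log_le_log hzp hz2
    rw [Real.log_mul (by norm_num) (Real.exp_pos _).ne', Real.log_exp] at this
    linarith
  have hz2' : 2 ≤ z := by
    have : (2:ℝ) ≤ z := by linarith
    exact_mod_cast this
  set K := 2 * ⌈19 * u^6⌉₊ + 1 with hK
  have hKodd : Odd K := ⟨_, rfl⟩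
  have hK1 : 38 * u^6 ≤ K := by
    have := Nat.le_ceil (19 * u^6)
    rw [hK]; push_cast; linarith
  have hK2 : (K:ℝ) ≤ 38 * u^6 + 3 := by
    have := Nat.ceil_lt_add_one (show 0 ≤ 19 * u^6 by positivity)
    rw [hK]; push_cast; linarith
  have main := pair_count X h z K hKodd hz2' hh
  have hr := recip_le z (by linarith)
  have hsq : √(Real.log z) ≤ 2 * u^6 := by
    apply Real.sqrt_le_iff.2
    refine ⟨by positivity, ?_⟩
    nlinarith
  have t1 : Real.exp (2 * Real.exp 1 * (∑ p ∈ z.primesBelow, 1 / (p:ℝ)) - K) ≤ Real.exp (-u) := by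
    apply Real.exp_le_exp.2
    have hs : ∑ p ∈ z.primesBelow, 1 / (p:ℝ) ≤ 6 * u^6 := by linarith
    have hs0 : 0 ≤ ∑ p ∈ z.primesBelow, 1 / (p:ℝ) := sum_nonneg fun _ _ => by positivity
    have : 2 * Real.exp 1 * (∑ p ∈ z.primesBelow, 1 / (p:ℝ)) ≤ 2 * 3 * (6 * u^6) := by
      have := two_exp_le
      gcongr
    have : u ≤ u^6 := le_self_pow₀ (by linarith) (by norm_num)
    linarith
  have t2 : ((Nat.log 2 h + 1 : ℝ) / Real.log z) ^ 2 ≤ 1 / u^22 := by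
    have hl : (Nat.log 2 h + 1 : ℝ) ≤ u := by
      have b1 : ((2:ℝ) ^ (Nat.log 2 h)) ≤ 2 * u^20 := by
        refine le_trans ?_ hhu
        exact_mod_cast Nat.pow_log_le_self 2 hh
      have b2 := Real.log_le_log (by positivity) b1
      rw [Real.log_pow, Real.log_mul (by norm_num) (by positivity), Real.log_pow] at b2
      push_cast at b2
      have : (Nat.log 2 h + 1 : ℝ) * Real.log 2 ≤ u * Real.log 2 := by linarith
      exact le_of_mul_le_mul_right this l20
    calc ((Nat.log 2 h + 1 : ℝ) / Real.log z) ^ 2 ≤ (u / u^12)^2 := by gcongr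
      _ = 1 / u^22 := by field_simp
  have e20 : u^18 * 169 ≤ u^20 := by
    have : u^20 = u^18 * u^2 := by ring
    rw [this]; gcongr; nlinarith
  have t3 : ((2:ℝ) * z)^K ≤ Real.exp (u^20 / 2) := by
    rw [← Real.log_le_iff_le_exp (by positivity), Real.log_pow, Real.log_mul (by norm_num) hzp.ne']
    have c1 : (K:ℝ) ≤ 41 * u^6 := by linarith
    have c2 : Real.log 2 + Real.log z ≤ 2 * u^12 := by linarith
    calc (K:ℝ) * (Real.log 2 + Real.log z) ≤ 41 * u^6 * (2 * u^12) := by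
          apply mul_le_mul c1 c2 (by linarith) (by positivity)
      _ = 82 * u^18 := by ring
      _ ≤ _ := by linarith
  have t4 : (z:ℝ) ≤ Real.exp (u^20/2) := by
    rw [← Real.log_le_iff_le_exp hzp]
    have : u^12 ≤ u^18 := pow_le_pow_right₀ (by linarith) (by norm_num)
    linarith
  have t5 : Real.exp (u^20/2) ≤ X * Real.exp (-u) := by
    rw [hXe, ← Real.exp_add]
    apply Real.exp_le_exp.2
    have : u ≤ u^18 := le_self_pow₀ (by linarith) (by norm_num)
    linarith
  have t6 : 3 * Real.exp (-u) ≤ 1 / u^22 := by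
    rw [Real.exp_neg, le_div_iff₀ (by positivity)]
    rw [mul_assoc, mul_comm, mul_assoc, inv_mul_le_iff₀ (Real.exp_pos u)]
    linarith
  have t7 : X * (((Nat.log 2 h + 1) / Real.log z) ^ 2 +
       Real.exp (2 * Real.exp 1 * (∑ p ∈ z.primesBelow, 1 / (p:ℝ)) - K)) ≤ X * (1/u^22 + Real.exp (-u)) := by
    gcongr
  have t8 : X * (1/u^22 + 3 * Real.exp (-u)) ≤ X * (1/u^22 + 1/u^22) := by gcongr
  calc _ ≤ _ := main
    _ ≤ X * (1/u^22 + 3 * Real.exp (-u)) := by linarith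
    _ ≤ X * (1/u^22 + 1/u^22) := t8
    _ = _ := by ring

open Finset in
lemma final_contra (N0 : ℕ) (H : ∀ k ≥ N0, Real.log ((k:ℝ) + 1) ≤
    (Nat.nth Nat.Prime (k+1) : ℝ) - Nat.nth Nat.Prime k) : False := by
  set P : ℕ → ℕ := Nat.nth Nat.Prime with hP
  have hmono : StrictMono P := Nat.nth_strictMono Nat.infinite_setOfPred_prime
  have hPk : ∀ k, k + 2 ≤ P k := Nat.add_two_le_nth_prime
  have hprime : ∀ k, (P k).Prime := Nat.prime_nth_prime
  have hf : ∃ᶠ k in Filter.atTop, (P k : ℝ) < (k + 1) * Real.log (P k) := freq_small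
  have ht0 : Filter.Tendsto (fun k => Real.log (P k : ℝ)) Filter.atTop Filter.atTop := by
    refine Real.tendsto_log_atTop.comp ?_
    apply Filter.tendsto_atTop_mono (f := fun M : ℕ => (M:ℝ)) _ tendsto_natCast_atTop_atTop
    intro k
    have := hPk k
    exact_mod_cast (by omega : k ≤ P k)
  have ht : Filter.Tendsto (fun k => (Real.log (P k : ℝ)) ^ (1/20 : ℝ)) Filter.atTop Filter.atTop :=
    (tendsto_rpow_atTop (by norm_num)).comp ht0
  have a1 : ∀ᶠ u : ℝ in Filter.atTop, 20 * Real.log u + 5 ≤ u / 2 := by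
    have := Real.isLittleO_log_id_atTop.bound (c := 1 / 80) (by positivity)
    filter_upwards [this, Filter.eventually_ge_atTop 40] with u hu hu4
    simp only [id, Real.norm_eq_abs] at hu
    rw [abs_of_nonneg (by linarith : (0:ℝ) ≤ u)] at hu
    have := (le_abs_self _).trans hu
    linarith
  have a2 : ∀ᶠ u : ℝ in Filter.atTop, u ^ 20 * u ^ 20 ≤ Real.exp (u^20) := by
    have := (Real.isLittleO_pow_exp_atTop (n := 2)).bound (c := 1) (by norm_num)
    have h20 : Filter.Tendsto (fun u : ℝ => u^20) Filter.atTop Filter.atTop :=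
      Filter.tendsto_pow_atTop (by norm_num)
    filter_upwards [h20.eventually this] with u hu
    simp only [Real.norm_eq_abs, Real.abs_exp] at hu
    have := (le_abs_self _).trans hu
    linarith
  have hlarge : ∀ᶠ k : ℕ in Filter.atTop, Real.log (N0.factorial) ≤ k :=
    tendsto_natCast_atTop_atTop.eventually_ge_atTop _
  obtain ⟨n, hn, ⟨hA1, hA2, hpair, hu⟩, hn4, hnC⟩ := (hf.and_eventually ((ht.eventually
    (a1.and (a2.and (pair_bound.and (Filter.eventually_ge_atTop 64))))).and
    ((Filter.eventually_ge_atTop (4 * N0 + 8)).and hlarge))).exists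
  set u := (Real.log (P n : ℝ)) ^ (1/20 : ℝ) with hudef
  have hX2 : (n:ℝ) + 2 ≤ P n := by exact_mod_cast hPk n
  have n8 : (8:ℝ) ≤ n := by exact_mod_cast (by omega : 8 ≤ n)
  have hX0 : (0:ℝ) < P n := by linarith
  have hL : Real.log (P n : ℝ) = u^20 := by
    rw [hudef, ← Real.rpow_natCast, ← Real.rpow_mul (Real.log_natCast_nonneg _)]
    norm_num
  have hXe : (P n : ℝ) = Real.exp (u^20) := by rw [← hL, Real.exp_log hX0]
  rw [hL] at hn
  have hB := hpair (P n) hL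
  have u20 : u ≤ u^20 := le_self_pow₀ (by linarith) (by norm_num)
  have u20p : 0 < u^20 := by positivity
  -- size facts
  have hLn : u^20 ≤ n + 1 := by
    rw [← hXe] at hA2
    have : u^20 * u^20 ≤ (n+1) * u^20 := by linarith
    exact le_of_mul_le_mul_right this u20p
  have hlogn1 : Real.log n ≤ u^20 := by
    rw [← hL]; exact Real.log_le_log (by linarith) (by linarith)
  have hlogn2 : u^20 - 1 - 20 * Real.log u ≤ Real.log n := by
    have h1 : (P n : ℝ) ≤ 2 * n * u^20 := by nlinarith
    have h2 := Real.log_le_log hX0 h1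
    rw [hL, Real.log_mul (by positivity) (by positivity), Real.log_mul (by norm_num) (by positivity),
      Real.log_pow] at h2
    push_cast at h2
    linarith [Real.log_two_lt_d9]
  set m := n / 4 with hm
  set Bad := (Ico m n).filter (fun k => (P (k+1) : ℝ) - P k < Real.log ((k:ℝ)+1) + u) with hBad
  set Hs := Icc ⌈Real.log n - 2⌉₊ ⌊Real.log n + u⌋₊ with hHs
  have hlogn : 2 < Real.log n - 2 := by
    have : 64 ≤ u := hu
    have : u * 64 ≤ u^20 := by
      calc u * 64 ≤ u * u := by gcongr
        _ = u^2 := by ring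
        _ ≤ u^20 := pow_le_pow_right₀ (by linarith) (by norm_num)
    linarith
  have hHcard : (Hs.card : ℝ) ≤ u + 3 := by
    rw [hHs, Nat.card_Icc]
    have h1 := Nat.floor_le (show 0 ≤ Real.log n + u by linarith)
    have h2 := Nat.le_ceil (Real.log n - 2)
    have h3 : ⌈Real.log n - 2⌉₊ ≤ ⌊Real.log n + u⌋₊ + 1 := by
      have : ⌈Real.log n - 2⌉₊ ≤ ⌊Real.log n + u⌋₊ := by
        apply Nat.le_floor
        have := Nat.ceil_lt_add_one (show 0 ≤ Real.log n - 2 by linarith)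
        linarith
      omega
    rw [Nat.cast_sub h3]
    push_cast
    linarith
  have hBadle : Bad.card ≤ ∑ h ∈ Hs, ((range (P n)).filter (fun q => q.Prime ∧ (q + h).Prime)).card := by
    refine le_trans ?_ card_biUnion_le
    apply card_le_card_of_injOn P
    · intro k hk
      have hk := Finset.mem_coe.1 hk
      rw [hBad, mem_filter, mem_Ico] at hk
      obtain ⟨⟨hk1, hk2⟩, hk3⟩ := hk
      have hlt : P k < P (k+1) := hmono (Nat.lt_succ_self k)
      have hge := H k (by omega)
      have hcast : ((P (k+1) - P k : ℕ) : ℝ) = (P (k+1) : ℝ) - P k := by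
        rw [Nat.cast_sub hlt.le]
      have hk4 : (n:ℝ) ≤ 4 * ((k:ℝ) + 1) := by exact_mod_cast (by omega : n ≤ 4 * (k+1))
      have hk5 : (k:ℝ) + 1 ≤ n := by exact_mod_cast hk2
      have k0 : (0:ℝ) ≤ k := by positivity
      have hl1 : Real.log n - 2 ≤ Real.log ((k:ℝ)+1) := by
        have := Real.log_le_log (by linarith) hk4
        rw [Real.log_mul (by norm_num) (by positivity)] at this
        have h4 : Real.log 4 ≤ 2 := by
          have : (4:ℝ) = 2^2 := by norm_num
          rw [this, Real.log_pow]; have := Real.log_two_lt_d9; push_cast; linarith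
        linarith
      have hl2 : Real.log ((k:ℝ)+1) ≤ Real.log n := Real.log_le_log (by positivity) hk5
      simp only [coe_biUnion, Set.mem_iUnion]
      refine ⟨P (k+1) - P k, ?_, ?_⟩
      · rw [hHs, Finset.mem_coe, mem_Icc]
        constructor
        · apply Nat.ceil_le.2; rw [hcast]; linarith
        · apply Nat.le_floor; rw [hcast]; linarith
      · rw [Finset.mem_coe, mem_filter, mem_range]
        refine ⟨hmono hk2, hprime k, ?_⟩
        rw [Nat.add_sub_cancel' hlt.le]; exact hprime _
    · exact hmono.injective.injOn
  have hBad2 : (Bad.card : ℝ) ≤ (u+3) * (2 * P n / u^22) := by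
    have h1 : (Bad.card : ℝ) ≤ ∑ h ∈ Hs, (((range (P n)).filter (fun q => q.Prime ∧ (q + h).Prime)).card : ℝ) := by
      exact_mod_cast hBadle
    have h2 : ∀ h ∈ Hs, (((range (P n)).filter (fun q => q.Prime ∧ (q + h).Prime)).card : ℝ) ≤ 2 * P n / u^22 := by
      intro h hh
      rw [hHs, mem_Icc] at hh
      have h3 := Nat.ceil_le.1 hh.1
      have h4 := (Nat.le_floor_iff (show 0 ≤ Real.log n + u by linarith)).1 hh.2
      apply hB h
      · rintro rfl
        simp at h3; linarith
      · linarith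
    refine h1.trans ((sum_le_sum h2).trans ?_)
    rw [sum_const, nsmul_eq_mul]
    gcongr
  have hBad3 : (Bad.card : ℝ) ≤ n / 4 := by
    refine hBad2.trans ?_
    have h1 : (u+3) * (2 * P n / u^22) ≤ (2*u) * (2 * ((n+1) * u^20) / u^22) := by
      gcongr
      linarith
    have h2 : (2*u) * (2 * ((n+1) * u^20) / u^22) = 4 * (n+1) / u := by field_simp; ring
    rw [h2] at h1
    refine h1.trans ?_
    rw [div_le_iff₀ (by linarith)]
    nlinarith
  -- telescoping
  have htel : ∑ k ∈ Ico N0 n, ((P (k+1) : ℝ) - P k) = P n - P N0 :=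
    sum_Ico_sub (fun k => (P k : ℝ)) (by omega)
  have hpt : ∀ k ∈ Ico N0 n, Real.log ((k:ℝ)+1) + (if k ∈ Ico m n \ Bad then u else 0) ≤ (P (k+1) : ℝ) - P k := by
    intro k hk
    rw [mem_Ico] at hk
    split_ifs with hh
    · rw [mem_sdiff, hBad, mem_filter] at hh
      by_contra hc
      exact hh.2 ⟨hh.1, not_le.1 hc⟩
    · linarith [H k hk.1]
  have hsum := sum_le_sum hpt
  rw [htel, sum_add_distrib] at hsum
  have hs1 : ∑ k ∈ Ico N0 n, Real.log ((k:ℝ)+1) = Real.log n.factorial - Real.log N0.factorial := by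
    rw [← sum_Ico_sub (fun k => Real.log (k.factorial : ℝ)) (by omega : N0 ≤ n)]
    apply sum_congr rfl
    intro k _
    rw [Nat.factorial_succ]
    push_cast
    rw [Real.log_mul (by positivity) (by positivity)]
    ring
  have hs2 : ∑ k ∈ Ico N0 n, (if k ∈ Ico m n \ Bad then u else 0) = ((Ico m n \ Bad).card : ℝ) * u := by
    rw [← sum_filter, sum_const, nsmul_eq_mul]
    congr 3
    ext k
    simp only [mem_filter, mem_sdiff, mem_Ico]
    constructor
    · exact fun h => h.2
    · intro h; exact ⟨⟨by omega, h.1.2⟩, h⟩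
  have hc : (n:ℝ)/2 ≤ ((Ico m n \ Bad).card : ℝ) := by
    have h1 := le_card_sdiff Bad (Ico m n)
    rw [Nat.card_Ico] at h1
    have h2 : n ≤ (Ico m n \ Bad).card + Bad.card + m := by omega
    have h3 : (n:ℝ) ≤ (Ico m n \ Bad).card + Bad.card + m := by exact_mod_cast h2
    have h4 : (m:ℝ) ≤ n/4 := by
      rw [hm]; have := @Nat.cast_div_le ℝ _ _ _ n 4; simpa using this
    linarith
  have hfact := log_fact_ge n
  rw [hs1, hs2] at hsum
  have hcu : (n:ℝ)/2 * u ≤ ((Ico m n \ Bad).card : ℝ) * u := by gcongr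
  have hPN : (0:ℝ) ≤ P N0 := by positivity
  have f1 : n * (u^20 - 1 - 20 * Real.log u) ≤ n * Real.log n := by gcongr
  have f2 : (n:ℝ) * (20 * Real.log u + 5) ≤ n * (u/2) := by gcongr
  nlinarith

theorem gap_lt_nlogn_difference :
    {n : ℕ | p (n + 1) - p n <
      (n + 1 : ℝ) * Real.log (n + 1) - (n : ℝ) * Real.log n + 1}.Infinite := by
  intro hfin
  obtain ⟨N, hN⟩ := hfin.bddAbove
  apply final_contra (N + 1)
  intro k hk
  have h1 : k + 1 ∉ {n : ℕ | p (n + 1) - p n <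
      (n + 1 : ℝ) * Real.log (n + 1) - (n : ℝ) * Real.log n + 1} := by
    intro h
    have := hN h
    omega
  simp only [Set.mem_setOf_eq, not_lt, p, Nat.add_sub_cancel] at h1
  push_cast at h1
  have k0 : (0:ℝ) ≤ k := by positivity
  have h2 : Real.log ((k:ℝ)+1) ≤ Real.log ((k:ℝ)+1+1) := Real.log_le_log (by linarith) (by linarith)
  have h3 : ((k:ℝ)+1) * Real.log ((k:ℝ)+1) ≤ ((k:ℝ)+1) * Real.log ((k:ℝ)+1+1) := by gcongr
  have h4 : ((k:ℝ)+1+1) * Real.log ((k:ℝ)+1+1) = ((k:ℝ)+1) * Real.log ((k:ℝ)+1+1) + Real.log ((k:ℝ)+1+1) := by ring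
  linarith
end

section
/- Define q_n = n log n if n is even and q_n = (n-1) log n if n is odd. Then along even n, p_n * (q_{n+1} - q_n + 1)/q_n tends to 2 as n → ∞, and along odd n, p_n * (q_{n+1} - q_n + 1)/q_n tends to ∞. -/
section PNT

open Filter Topology MeasureTheory Set

noncomputable def fejK (v : ℝ) : ℝ := 2 * (1 - Real.cos v) / v ^ 2

lemma fejK_nonneg (v : ℝ) : 0 ≤ fejK v := by
  unfold fejK
  have := Real.cos_le_one v
  positivity [sub_nonneg.2 this]

lemma fejK_le (v : ℝ) : fejK v ≤ 5 * (1 + v ^ 2)⁻¹ := by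
  unfold fejK
  rcases eq_or_ne v 0 with rfl | hv
  · simp
  · have h1 := Real.one_sub_sq_div_two_le_cos (x := v)
    have h2 := Real.neg_one_le_cos v
    have : 0 < v ^ 2 := by positivity
    rw [← div_eq_mul_inv, div_le_div_iff₀ this (by positivity)]
    nlinarith

lemma fejK_measurable : Measurable fejK := by
  unfold fejK
  fun_prop

lemma fejK_integrable : Integrable fejK := by
  refine (integrable_inv_one_add_sq.const_mul 5).mono' fejK_measurable.aestronglyMeasurable ?_
  filter_upwards with v
  rw [Real.norm_of_nonneg (fejK_nonneg v)]
  exact fejK_le v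

lemma fejK_integral_pos : 0 < ∫ v, fejK v := by
  rw [integral_pos_iff_support_of_nonneg fejK_nonneg fejK_integrable]
  refine lt_of_lt_of_le (b := volume (Ioo (0:ℝ) 1)) (by simp) (measure_mono ?_)
  intro v hv
  have h1 : Real.cos v < 1 := by
    have := Real.cos_lt_cos_of_nonneg_of_le_pi le_rfl (by linarith [hv.2, Real.pi_gt_three] : v ≤ Real.pi) hv.1
    simpa using this
  have : 0 < v := hv.1
  have h2 : 0 < 1 - Real.cos v := by linarith
  simp only [Function.mem_support, fejK]
  positivity

lemma fejK_neg (v : ℝ) : fejK (-v) = fejK v := by simp [fejK]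

open intervalIntegral in
lemma fejK_fourier {v : ℝ} (hv : v ≠ 0) :
    ∫ τ in (-1:ℝ)..1, ((1 - |τ| : ℝ) : ℂ) * Complex.exp (-(Complex.I * v * τ)) = fejK v := by
  set c : ℂ := -(Complex.I * v) with hc
  have hc0 : c ≠ 0 := by simp [hc, hv]
  have e1 : ∀ τ : ℝ, HasDerivAt (fun τ : ℝ => (Complex.exp (c * τ))) (Complex.exp (c * τ) * c) τ := by
    intro τ
    have : HasDerivAt (fun z : ℂ => Complex.exp (c * z)) (Complex.exp (c * τ) * c) (τ : ℂ) := by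
      simpa using ((hasDerivAt_id (τ:ℂ)).const_mul c).cexp
    exact this.comp_ofReal
  have e2 : ∀ τ : ℝ, HasDerivAt (fun τ : ℝ => (τ : ℂ)) 1 τ := fun τ => (hasDerivAt_id (τ:ℂ)).comp_ofReal
  have i1 : ∫ τ in (0:ℝ)..1, (1 - (τ:ℂ)) * Complex.exp (c * τ) = Complex.exp c / c ^ 2 - 1 / c - 1 / c ^ 2 := by
    rw [integral_eq_sub_of_hasDerivAt (f := fun τ : ℝ => (1 - (τ:ℂ)) * Complex.exp (c * τ) / c + Complex.exp (c * τ) / c ^ 2)]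
    · simp; ring
    · intro τ _
      have := ((((e2 τ).const_sub 1).mul (e1 τ)).div_const c).add ((e1 τ).div_const (c ^ 2))
      refine this.congr_deriv ?_
      field_simp; ring
    · apply Continuous.intervalIntegrable; fun_prop
  have i2 : ∫ τ in (-1:ℝ)..0, (1 + (τ:ℂ)) * Complex.exp (c * τ) = 1 / c - 1 / c ^ 2 + Complex.exp (-c) / c ^ 2 := by
    rw [integral_eq_sub_of_hasDerivAt (f := fun τ : ℝ => (1 + (τ:ℂ)) * Complex.exp (c * τ) / c - Complex.exp (c * τ) / c ^ 2)]
    · simp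
    · intro τ _
      have := ((((e2 τ).const_add 1).mul (e1 τ)).div_const c).sub ((e1 τ).div_const (c ^ 2))
      refine this.congr_deriv ?_
      field_simp; ring
    · apply Continuous.intervalIntegrable; fun_prop
  have hcont : Continuous fun τ : ℝ => ((1 - |τ| : ℝ) : ℂ) * Complex.exp (-(Complex.I * v * τ)) := by fun_prop
  rw [← integral_add_adjacent_intervals (b := 0) (hcont.intervalIntegrable _ _) (hcont.intervalIntegrable _ _)]
  have j2 : ∫ τ in (-1:ℝ)..0, ((1 - |τ| : ℝ) : ℂ) * Complex.exp (-(Complex.I * v * τ)) = ∫ τ in (-1:ℝ)..0, (1 + (τ:ℂ)) * Complex.exp (c * τ) := by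
    apply integral_congr
    intro τ hτ
    rw [uIcc_of_le (by norm_num)] at hτ
    simp only [abs_of_nonpos hτ.2, hc]
    push_cast; ring_nf
  have j1 : ∫ τ in (0:ℝ)..1, ((1 - |τ| : ℝ) : ℂ) * Complex.exp (-(Complex.I * v * τ)) = ∫ τ in (0:ℝ)..1, (1 - (τ:ℂ)) * Complex.exp (c * τ) := by
    apply integral_congr
    intro τ hτ
    rw [uIcc_of_le (by norm_num)] at hτ
    simp only [abs_of_nonneg hτ.1, hc]
    push_cast; ring_nf
  rw [j1, j2, i1, i2]
  have hcos : Complex.exp c + Complex.exp (-c) = 2 * Complex.cos v := by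
    rw [Complex.cos, hc]; ring_nf
  have hc2 : c ^ 2 = -(v:ℂ) ^ 2 := by rw [hc]; ring_nf; simp
  have hv' : (v:ℂ) ≠ 0 := by exact_mod_cast hv
  calc _ = ((Complex.exp c + Complex.exp (-c)) - 2) / c ^ 2 := by ring
    _ = _ := by
      rw [hcos, hc2, fejK]; push_cast; field_simp; ring

lemma smooth_sigma {g : ℝ → ℝ} (hgm : Measurable g) {M : ℝ} (hM : ∀ t, |g t| ≤ M)
    {G : ℂ → ℂ} (hL : ∀ s : ℂ, 0 < s.re → ∫ t in Ioi (0:ℝ), (g t : ℂ) * Complex.exp (-(s * t)) = G s)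
    {l : ℝ} (hl : 0 < l) {σ : ℝ} (hσ : 0 < σ) (y : ℝ) :
    ∫ t in Ioi (0:ℝ), (g t : ℂ) * Complex.exp (-(σ * t)) * (fejK (l * (t - y)) : ℂ) =
      ∫ τ in Ioc (-1:ℝ) 1, ((1 - |τ| : ℝ) : ℂ) * Complex.exp (Complex.I * l * τ * y) *
        G (σ + Complex.I * l * τ) := by
  have h1 : ∫ t in Ioi (0:ℝ), (g t : ℂ) * Complex.exp (-(σ * t)) * (fejK (l * (t - y)) : ℂ) =
      ∫ t in Ioi (0:ℝ), ∫ τ in Ioc (-1:ℝ) 1, (g t : ℂ) * Complex.exp (-(σ * t)) *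
       (((1 - |τ| : ℝ) : ℂ) * Complex.exp (-(Complex.I * (l * (t - y) : ℝ) * τ))) := by
    apply integral_congr_ae
    apply ae_restrict_of_ae
    have : ∀ᵐ t : ℝ, t ≠ y := by
      simp [ae_iff]
    filter_upwards [this] with t ht
    have hne : l * (t - y) ≠ 0 := mul_ne_zero hl.ne' (sub_ne_zero.2 ht)
    rw [integral_const_mul, ← fejK_fourier hne, intervalIntegral.integral_of_le (by norm_num)]
  rw [h1, integral_integral_swap]
  · apply integral_congr_ae
    filter_upwards with τ
    rw [← hL _ (by simp [hσ]), ← integral_const_mul]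
    apply integral_congr_ae
    filter_upwards with t
    have : Complex.exp (-(σ * t)) * Complex.exp (-(Complex.I * (l * (t - y) : ℝ) * τ)) =
        Complex.exp (Complex.I * l * τ * y) * Complex.exp (-((σ + Complex.I * l * τ) * t)) := by
      rw [← Complex.exp_add, ← Complex.exp_add]; congr 1; push_cast; ring
    linear_combination ((g t : ℂ) * ((1 - |τ| : ℝ) : ℂ)) * this
  · have hI : Integrable (fun z : ℝ × ℝ => (M * Real.exp (-σ * z.1)) * (1:ℝ))
        ((volume.restrict (Ioi (0:ℝ))).prod (volume.restrict (Ioc (-1:ℝ) 1))) := by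
      apply Integrable.mul_prod (f := fun t => M * Real.exp (-σ * t)) (g := fun _ => (1:ℝ))
      · exact (integrableOn_exp_mul_Ioi (by linarith) 0).const_mul M
      · exact integrable_const _
    refine hI.mono' ?_ ?_
    · apply Measurable.aestronglyMeasurable
      unfold Function.uncurry
      fun_prop
    · have : ∀ᵐ z ∂((volume.restrict (Ioi (0:ℝ))).prod (volume.restrict (Ioc (-1:ℝ) 1))), z ∈ (Ioi (0:ℝ)) ×ˢ (Ioc (-1:ℝ) 1) := by
        rw [Measure.prod_restrict]
        exact ae_restrict_mem (measurableSet_Ioi.prod measurableSet_Ioc)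
      filter_upwards [this] with z hz
      obtain ⟨t, τ⟩ := z
      simp only [Function.uncurry, norm_mul, Complex.norm_exp, mul_one, Complex.norm_real]
      have e1 : (-((σ:ℂ) * t)).re = -σ * t := by simp
      have e2 : (-(Complex.I * (l * (t - y) : ℝ) * τ)).re = 0 := by simp
      rw [e1, e2, Real.exp_zero, mul_one]
      have h3 : ‖1 - |τ|‖ ≤ 1 := by
        have h4 : |τ| ≤ 1 := abs_le.2 ⟨hz.2.1.le, hz.2.2⟩
        rw [Real.norm_eq_abs, abs_le]; constructor <;> linarith [abs_nonneg τ]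
      have h5 : ‖g t‖ ≤ M := hM t
      calc _ ≤ M * Real.exp (-σ * t) * 1 := by
            have := (norm_nonneg _).trans h5
            gcongr
        _ = _ := by ring

lemma smooth_zero {g : ℝ → ℝ} (hgm : Measurable g) {M : ℝ} (hM : ∀ t, |g t| ≤ M)
    {G : ℂ → ℂ} (hL : ∀ s : ℂ, 0 < s.re → ∫ t in Ioi (0:ℝ), (g t : ℂ) * Complex.exp (-(s * t)) = G s)
    (hG : ContinuousOn G {s | 0 ≤ s.re})
    {l : ℝ} (hl : 0 < l) (y : ℝ) :
    ∫ t in Ioi (0:ℝ), (g t : ℂ) * (fejK (l * (t - y)) : ℂ) =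
      ∫ τ in Ioc (-1:ℝ) 1, ((1 - |τ| : ℝ) : ℂ) * Complex.exp (Complex.I * l * τ * y) *
        G (Complex.I * l * τ) := by
  have hKi : Integrable (fun t => fejK (l * (t - y))) :=
    (fejK_integrable.comp_mul_left' hl.ne').comp_sub_right y
  have hKm := fejK_measurable
  have hM0 : 0 ≤ M := (abs_nonneg _).trans (hM 0)
  have t1 : Tendsto (fun σ : ℝ => ∫ t in Ioi (0:ℝ), (g t : ℂ) * Complex.exp (-(σ * t)) * (fejK (l * (t - y)) : ℂ))
      (𝓝[>] 0) (𝓝 (∫ t in Ioi (0:ℝ), (g t : ℂ) * (fejK (l * (t - y)) : ℂ))) := by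
    apply tendsto_integral_filter_of_dominated_convergence (fun t => M * fejK (l * (t - y)))
    · filter_upwards with σ
      apply Measurable.aestronglyMeasurable
      fun_prop
    · filter_upwards [self_mem_nhdsWithin] with σ hσ
      filter_upwards [ae_restrict_mem measurableSet_Ioi] with t ht
      simp only [norm_mul, Complex.norm_exp, Complex.norm_real]
      have e1 : (-((σ:ℂ) * t)).re = -(σ * t) := by simp
      rw [e1, Real.norm_of_nonneg (fejK_nonneg _)]
      have h5 : ‖g t‖ ≤ M := hM t
      have h6 : Real.exp (-(σ * t)) ≤ 1 := by
        rw [Real.exp_le_one_iff]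
        have : 0 < σ * t := mul_pos hσ ht
        linarith
      have h7 := fejK_nonneg (l * (t - y))
      calc _ ≤ M * 1 * fejK (l * (t - y)) := by gcongr
        _ = _ := by ring
    · exact (hKi.const_mul M).restrict
    · filter_upwards with t
      refine tendsto_nhdsWithin_of_tendsto_nhds ?_
      have : Continuous fun σ : ℝ => (g t : ℂ) * Complex.exp (-(σ * t)) * (fejK (l * (t - y)) : ℂ) := by fun_prop
      simpa using this.tendsto 0
  obtain ⟨C, hC⟩ : ∃ C, ∀ z ∈ (Icc (0:ℝ) 1) ×ˢ (Icc (-1:ℝ) 1), ‖G (z.1 + Complex.I * l * z.2)‖ ≤ C := by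
    apply (isCompact_Icc.prod isCompact_Icc).exists_bound_of_continuousOn (f := fun z : ℝ × ℝ => G (z.1 + Complex.I * l * z.2))
    refine hG.comp (by fun_prop) ?_
    intro z hz
    simpa using hz.1.1
  have t2 : Tendsto (fun σ : ℝ => ∫ τ in Ioc (-1:ℝ) 1, ((1 - |τ| : ℝ) : ℂ) * Complex.exp (Complex.I * l * τ * y) *
        G (σ + Complex.I * l * τ)) (𝓝[>] 0) (𝓝 (∫ τ in Ioc (-1:ℝ) 1, ((1 - |τ| : ℝ) : ℂ) * Complex.exp (Complex.I * l * τ * y) *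
        G (Complex.I * l * τ))) := by
    apply tendsto_integral_filter_of_dominated_convergence (fun t => C)
    · filter_upwards [self_mem_nhdsWithin] with σ hσ
      apply Continuous.aestronglyMeasurable
      have : Continuous fun τ : ℝ => G (σ + Complex.I * l * τ) := by
        apply hG.comp_continuous (by fun_prop)
        intro τ
        simpa using le_of_lt hσ
      exact Continuous.mul (by fun_prop) this
    · filter_upwards [Ioc_mem_nhdsGT (zero_lt_one' ℝ)] with σ hσ
      filter_upwards [ae_restrict_mem measurableSet_Ioc] with τ hτ
      simp only [norm_mul, Complex.norm_exp, Complex.norm_real]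
      have e1 : (Complex.I * l * τ * y).re = 0 := by simp
      rw [e1, Real.exp_zero, mul_one]
      have h3 : ‖1 - |τ|‖ ≤ 1 := by
        have h4 : |τ| ≤ 1 := abs_le.2 ⟨hτ.1.le, hτ.2⟩
        rw [Real.norm_eq_abs, abs_le]; constructor <;> linarith [abs_nonneg τ]
      have := hC (σ, τ) ⟨⟨hσ.1.le, hσ.2⟩, ⟨hτ.1.le, hτ.2⟩⟩
      calc _ ≤ 1 * C := by gcongr
        _ = C := one_mul C
    · exact integrable_const _
    · filter_upwards with τ
      apply Tendsto.const_mul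
      have h0 : (Complex.I * l * τ) ∈ {s : ℂ | 0 ≤ s.re} := by simp
      refine (hG _ h0).tendsto.comp (tendsto_nhdsWithin_iff.2 ⟨?_, ?_⟩)
      · refine tendsto_nhdsWithin_of_tendsto_nhds ?_
        have : Continuous fun σ : ℝ => (σ : ℂ) + Complex.I * l * τ := by fun_prop
        simpa using this.tendsto 0
      · filter_upwards [self_mem_nhdsWithin] with σ hσ
        simpa using le_of_lt hσ
  refine tendsto_nhds_unique t1 (t2.congr' ?_)
  filter_upwards [self_mem_nhdsWithin] with σ hσ
  exact (smooth_sigma hgm hM hL hl hσ y).symm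

lemma smooth_tendsto {g : ℝ → ℝ} (hgm : Measurable g) {M : ℝ} (hM : ∀ t, |g t| ≤ M)
    (hg0 : ∀ t ≤ 0, g t = 0)
    {G : ℂ → ℂ} (hL : ∀ s : ℂ, 0 < s.re → ∫ t in Ioi (0:ℝ), (g t : ℂ) * Complex.exp (-(s * t)) = G s)
    (hG : ContinuousOn G {s | 0 ≤ s.re})
    {l : ℝ} (hl : 0 < l) :
    Tendsto (fun y : ℝ => ∫ v, g (y + v / l) * fejK v) atTop (𝓝 0) := by
  have hRL := Real.tendsto_integral_exp_smul_cocompact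
    (fun τ : ℝ => (Ioc (-1:ℝ) 1).indicator (fun τ : ℝ => ((1 - |τ| : ℝ) : ℂ) * G (Complex.I * l * τ)) τ)
  have hw : Tendsto (fun y : ℝ => -(l / (2 * Real.pi)) * y) atTop (cocompact ℝ) := by
    refine Tendsto.mono_right ?_ atBot_le_cocompact
    apply Tendsto.const_mul_atTop_of_neg
    · have := Real.pi_pos
      have : 0 < l / (2 * Real.pi) := by positivity
      linarith
    · exact tendsto_id
  have h := hRL.comp hw
  have key : ∀ y : ℝ, ((∫ v, g (y + v / l) * fejK v : ℝ) : ℂ) = (l : ℂ) *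
      ∫ v : ℝ, Real.fourierChar (-(v * (-(l / (2 * Real.pi)) * y))) •
        (Ioc (-1:ℝ) 1).indicator (fun τ : ℝ => ((1 - |τ| : ℝ) : ℂ) * G (Complex.I * l * τ)) v := by
    intro y
    have c1 : ∫ v, g (y + v / l) * fejK v = l * ∫ t, g t * fejK (l * (t - y)) := by
      have e := Measure.integral_comp_mul_left (fun v => g (y + v / l) * fejK v) l
      rw [← integral_sub_right_eq_self _ y] at e
      rw [abs_of_pos (inv_pos.2 hl), smul_eq_mul] at e
      have e3 : (∫ v, g (y + v / l) * fejK v) = l * (l⁻¹ * ∫ v, g (y + v / l) * fejK v) := by field_simp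
      rw [e3, ← e]
      congr 2; ext t
      rw [mul_div_cancel_left₀ _ hl.ne']; ring_nf
    have c2 : ∫ t, g t * fejK (l * (t - y)) = ∫ t in Ioi (0:ℝ), g t * fejK (l * (t - y)) := by
      symm
      apply setIntegral_eq_integral_of_forall_compl_eq_zero
      intro t ht
      rw [hg0 t (by simpa using ht), zero_mul]
    rw [c1, c2, Complex.ofReal_mul, ← integral_complex_ofReal]
    congr 1
    have := smooth_zero hgm hM hL hG hl y
    push_cast
    rw [this, ← integral_indicator measurableSet_Ioc]
    congr 1; ext τ
    by_cases hτ : τ ∈ Ioc (-1:ℝ) 1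
    · simp only [indicator_of_mem hτ]
      rw [Circle.smul_def, Real.fourierChar_apply, smul_eq_mul]
      have : ((2 * Real.pi * (-(τ * (-(l / (2 * Real.pi)) * y))) : ℝ) : ℂ) * Complex.I = Complex.I * l * τ * y := by
        have hp : (Real.pi : ℂ) ≠ 0 := by exact_mod_cast Real.pi_ne_zero
        push_cast; field_simp
      rw [this]; push_cast; ring
    · simp [indicator_of_notMem hτ]
  have h2 : Tendsto (fun y : ℝ => ((∫ v, g (y + v / l) * fejK v : ℝ) : ℂ)) atTop (𝓝 ((0:ℝ):ℂ)) := by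
    simp_rw [key]
    simpa using h.const_mul (l:ℂ)
  exact_mod_cast Complex.continuous_re.continuousAt.tendsto.comp h2

/-- A bounded function whose Fejer means tend to zero is not bounded below on long windows. -/
lemma taub_window {g : ℝ → ℝ} (hgm : Measurable g) {M : ℝ} (hM : ∀ t, |g t| ≤ M)
    (hJ : ∀ l : ℝ, 0 < l → Tendsto (fun y : ℝ => ∫ v, g (y + v / l) * fejK v) atTop (𝓝 0))
    {ε h : ℝ} (hε : 0 < ε) (hh : 0 < h) :
    ∀ᶠ y in atTop, ∃ t ∈ Icc (y - h) (y + h), g t < ε := by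
  have hM0 : 0 ≤ M := (abs_nonneg _).trans (hM 0)
  have hKm := fejK_measurable
  let F : ℝ → ℝ → ℝ := fun l v => (if |v| ≤ l * h then ε else -M) * fejK v
  have hFm : ∀ l, Measurable (F l) := by
    intro l
    apply Measurable.mul _ hKm
    apply Measurable.ite _ measurable_const measurable_const
    exact measurableSet_le (by fun_prop) measurable_const
  have hFb : ∀ l v, ‖F l v‖ ≤ (ε + M) * fejK v := by
    intro l v
    simp only [F, norm_mul, Real.norm_of_nonneg (fejK_nonneg v)]
    have := fejK_nonneg v
    gcongr
    split_ifs
    · rw [Real.norm_of_nonneg hε.le]; linarith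
    · rw [norm_neg, Real.norm_of_nonneg hM0]; linarith
  have hFl : Tendsto (fun l => ∫ v, F l v) atTop (𝓝 (∫ v, ε * fejK v)) := by
    apply tendsto_integral_filter_of_dominated_convergence (fun v => (ε + M) * fejK v)
    · exact Eventually.of_forall fun l => (hFm l).aestronglyMeasurable
    · exact Eventually.of_forall fun l => Eventually.of_forall (hFb l)
    · exact fejK_integrable.const_mul _
    · filter_upwards with v
      apply tendsto_const_nhds.congr'
      filter_upwards [eventually_ge_atTop (|v| / h)] with l hl
      have : |v| ≤ l * h := by rwa [div_le_iff₀ hh] at hl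
      simp [F, this]
  rw [integral_const_mul] at hFl
  have hpos := mul_pos hε fejK_integral_pos
  obtain ⟨l, hl0, hl⟩ := ((eventually_gt_atTop 0).and (hFl.eventually (lt_mem_nhds hpos))).exists
  filter_upwards [(hJ l hl0).eventually (gt_mem_nhds hl)] with y hy
  by_contra! hcon
  apply absurd hy
  rw [not_lt]
  have hgi : Integrable (fun v => g (y + v / l) * fejK v) := by
    refine (fejK_integrable.const_mul M).mono' (by fun_prop) ?_
    filter_upwards with v
    rw [norm_mul, Real.norm_of_nonneg (fejK_nonneg v)]
    have := fejK_nonneg v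
    gcongr
    exact hM _
  have hFi : Integrable (F l) := (fejK_integrable.const_mul (ε + M)).mono'
    (hFm l).aestronglyMeasurable (Eventually.of_forall (hFb l))
  refine integral_mono hFi hgi fun v => ?_
  refine mul_le_mul_of_nonneg_right ?_ (fejK_nonneg v)
  split_ifs with hv
  · apply hcon
    have : |v / l| ≤ h := by
      rw [abs_div, abs_of_pos hl0, div_le_iff₀ hl0]; linarith
    rw [abs_le] at this
    constructor <;> linarith [this.1, this.2]
  · exact (abs_le.1 (hM _)).1

lemma taub_main {b : ℝ → ℝ} {g : ℝ → ℝ} (hgm : Measurable g) {M : ℝ} (hM : ∀ t, |g t| ≤ M)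
    (hgb : ∀ t > 0, g t = b t - 1)
    (hb : ∀ t u, t ≤ u → b t * Real.exp t ≤ b u * Real.exp u)
    (hb0 : ∀ t, 0 ≤ b t)
    (hJ : ∀ l : ℝ, 0 < l → Tendsto (fun y : ℝ => ∫ v, g (y + v / l) * fejK v) atTop (𝓝 0)) :
    Tendsto b atTop (𝓝 1) := by
  have hexp : ∀ c : ℝ, 1 < c → ∃ h > 0, Real.exp (2 * h) ≤ c := by
    intro c hc
    refine ⟨Real.log c / 2, by have := Real.log_pos hc; positivity, ?_⟩
    rw [mul_div_cancel₀ _ two_ne_zero, Real.exp_log (by linarith)]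
  have hJ' : ∀ l : ℝ, 0 < l → Tendsto (fun y : ℝ => ∫ v, (fun t => -g t) (y + v / l) * fejK v) atTop (𝓝 0) := by
    intro l hl
    have := (hJ l hl).neg
    simp only [neg_zero, ← integral_neg] at this
    simpa using this
  rw [Metric.tendsto_atTop']
  suffices H : ∀ ε > 0, ∀ᶠ t in atTop, dist (b t) 1 < ε by
    intro ε hε
    obtain ⟨N, hN⟩ := eventually_atTop.1 (H ε hε)
    exact ⟨N, fun n hn => hN n (le_of_lt hn)⟩
  intro ε' hε'
  obtain ⟨ε, hε, hεε, h1⟩ : ∃ ε > 0, ε ≤ ε' ∧ ε < 1 :=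
    ⟨min ε' (1 / 2), by positivity, min_le_left _ _, by linarith [min_le_right ε' (1 / 2)]⟩
  have up : ∀ᶠ T in atTop, b T < 1 + ε := by
    obtain ⟨h, hh, hhe⟩ := hexp ((1 + ε) / (1 + ε / 2)) (by rw [one_lt_div (by positivity)]; linarith)
    have := taub_window hgm hM hJ (half_pos hε) hh
    have := (tendsto_atTop_add_const_right atTop h tendsto_id).eventually this
    filter_upwards [this, eventually_gt_atTop 0] with T ⟨t, ht, htg⟩ hT
    simp only [id, mem_Icc] at ht
    rw [hgb t (by linarith [ht.1])] at htg
    have h1 := hb T t (by linarith [ht.1])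
    have h2 : Real.exp t ≤ Real.exp T * Real.exp (2 * h) := by
      rw [← Real.exp_add]; exact Real.exp_le_exp.2 (by linarith [ht.2])
    have h3 : b T * Real.exp T ≤ (b t * Real.exp (2 * h)) * Real.exp T := by
      calc _ ≤ _ := h1
        _ ≤ b t * (Real.exp T * Real.exp (2 * h)) := by gcongr; exact hb0 t
        _ = _ := by ring
    have h4 := le_of_mul_le_mul_right h3 (Real.exp_pos T)
    calc b T ≤ _ := h4
      _ < (1 + ε / 2) * Real.exp (2 * h) := by
          have := Real.exp_pos (2 * h); gcongr; linarith
      _ ≤ (1 + ε / 2) * ((1 + ε) / (1 + ε / 2)) := by gcongr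
      _ = 1 + ε := by field_simp
  have lo : ∀ᶠ T in atTop, 1 - ε < b T := by
    obtain ⟨h, hh, hhe⟩ := hexp ((1 - ε / 2) / (1 - ε)) (by rw [one_lt_div (by linarith)]; linarith)
    have := taub_window hgm.neg (by simpa using hM) hJ' (half_pos hε) hh
    have := (tendsto_atTop_add_const_right atTop (-h) tendsto_id).eventually this
    filter_upwards [this, eventually_gt_atTop (2 * h)] with T ⟨t, ht, htg⟩ hT
    simp only [id, mem_Icc] at ht
    rw [Pi.neg_apply, hgb t (by linarith [ht.1])] at htg
    have h1' := hb t T (by linarith [ht.2])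
    have h2 : Real.exp T ≤ Real.exp t * Real.exp (2 * h) := by
      rw [← Real.exp_add]; exact Real.exp_le_exp.2 (by linarith [ht.1])
    have h3 : b t * Real.exp t ≤ (b T * Real.exp (2 * h)) * Real.exp t := by
      calc _ ≤ _ := h1'
        _ ≤ b T * (Real.exp t * Real.exp (2 * h)) := by gcongr; exact hb0 T
        _ = _ := by ring
    have h4 := le_of_mul_le_mul_right h3 (Real.exp_pos t)
    have h5 : 1 - ε / 2 < b T * ((1 - ε / 2) / (1 - ε)) := by
      calc _ < b t := by linarith
        _ ≤ _ := h4
        _ ≤ _ := by gcongr; exact hb0 T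
    rw [mul_div_assoc', lt_div_iff₀ (by linarith)] at h5
    nlinarith
  filter_upwards [up, lo] with T h3 h2
  rw [Real.dist_eq, abs_lt]; constructor <;> linarith

noncomputable def bPsi (t : ℝ) : ℝ := Chebyshev.psi (Real.exp t) * Real.exp (-t)

noncomputable def auxL (s : ℂ) : ℂ :=
  ArithmeticFunction.vonMangoldt.LFunctionResidueClassAux (1 : ZMod 1) s

lemma auxL_cont : ContinuousOn auxL {s | 1 ≤ s.re} :=
  ArithmeticFunction.vonMangoldt.continuousOn_LFunctionResidueClassAux (1 : ZMod 1)

lemma auxL_eq {s : ℂ} (hs : 1 < s.re) :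
    auxL s = LSeries (fun n => ((ArithmeticFunction.vonMangoldt n : ℝ) : ℂ)) s - 1 / (s - 1) := by
  have h := ArithmeticFunction.vonMangoldt.eqOn_LFunctionResidueClassAux (q := 1) (a := 1) isUnit_one hs
  rw [auxL, h]
  have : ArithmeticFunction.vonMangoldt.residueClass (1 : ZMod 1) = fun n => ArithmeticFunction.vonMangoldt n := by
    ext n
    simp [ArithmeticFunction.vonMangoldt.residueClass, Set.indicator, Subsingleton.elim _ (1 : ZMod 1)]
  simp [this]

lemma bPsi_meas : Measurable bPsi := by
  unfold bPsi
  have := Chebyshev.psi_mono.measurable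
  fun_prop

lemma bPsi_nonneg (t : ℝ) : 0 ≤ bPsi t :=
  mul_nonneg (Chebyshev.psi_nonneg _) (Real.exp_pos _).le

lemma bPsi_le (t : ℝ) : bPsi t ≤ Real.log 4 + 4 := by
  have := Chebyshev.psi_le_const_mul_self (Real.exp_pos t).le
  unfold bPsi
  calc _ ≤ (Real.log 4 + 4) * Real.exp t * Real.exp (-t) := by gcongr
    _ = _ := by rw [mul_assoc, ← Real.exp_add]; simp

lemma bPsi_laplace {s : ℂ} (hs : 0 < s.re) :
    ∫ t in Ioi (0:ℝ), (bPsi t : ℂ) * Complex.exp (-(s * t)) = (auxL (1 + s) + 1 / s) / (1 + s) := by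
  have hs1 : 1 < (1 + s).re := by simpa using hs
  have hO : (fun n : ℕ => ∑ k ∈ Finset.Icc 1 n, ArithmeticFunction.vonMangoldt k) =O[atTop] fun n => (n : ℝ) ^ (1:ℝ) := by
    apply Asymptotics.IsBigO.of_bound (Real.log 4 + 4)
    filter_upwards with n
    have h := Chebyshev.psi_le_const_mul_self (Nat.cast_nonneg (α := ℝ) n)
    have h0 := Chebyshev.psi_nonneg n
    have e : Chebyshev.psi n = ∑ k ∈ Finset.Icc 1 n, ArithmeticFunction.vonMangoldt k := by
      simp [Chebyshev.psi, ← Finset.Icc_add_one_left_eq_Ioc]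
    rw [← e, Real.norm_of_nonneg h0, Real.rpow_one, Real.norm_of_nonneg (Nat.cast_nonneg n)]
    exact h
  have h := LSeries_eq_mul_integral_of_nonneg (fun n => ArithmeticFunction.vonMangoldt n) zero_le_one hs1 hO
    (fun n => ArithmeticFunction.vonMangoldt_nonneg)
  rw [auxL_eq hs1, h]
  have hne : 1 + s ≠ 0 := by
    intro h0; rw [h0] at hs1; norm_num at hs1
  have hs0 : s ≠ 0 := by rintro rfl; simp at hs
  rw [add_sub_cancel_left, sub_add_cancel, mul_div_cancel_left₀ _ hne]
  rw [show (1:ℝ) = Real.exp 0 by simp, ← integral_comp_exp_Ioi]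
  apply setIntegral_congr_fun measurableSet_Ioi
  intro t ht
  have e : Chebyshev.psi (Real.exp t) = ∑ k ∈ Finset.Icc 1 ⌊Real.exp t⌋₊, ArithmeticFunction.vonMangoldt k := by
      simp [Chebyshev.psi, ← Finset.Icc_add_one_left_eq_Ioc]
  have e2 : ∑ k ∈ Finset.Icc 1 ⌊Real.exp t⌋₊, ((ArithmeticFunction.vonMangoldt k : ℝ) : ℂ) = (Chebyshev.psi (Real.exp t) : ℝ) := by
    rw [e]; push_cast; rfl
  simp only
  rw [e2, bPsi, Complex.real_smul, Complex.cpow_def_of_ne_zero (by simp), ← Complex.ofReal_log (Real.exp_pos t).le,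
    Real.log_exp]
  push_cast
  have : Complex.exp (-t) * Complex.exp (-(s * t)) = Complex.exp t * Complex.exp (t * -(1 + s + 1)) := by
    rw [← Complex.exp_add, ← Complex.exp_add]; congr 1; ring
  linear_combination (Chebyshev.psi (Real.exp t) : ℂ) * this

noncomputable def gPsi : ℝ → ℝ := (Ioi (0:ℝ)).indicator (fun t => bPsi t - 1)

lemma gPsi_laplace {s : ℂ} (hs : 0 < s.re) :
    ∫ t in Ioi (0:ℝ), (gPsi t : ℂ) * Complex.exp (-(s * t)) = (auxL (1 + s) - 1) / (1 + s) := by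
  have hs1 : 1 < (1 + s).re := by simpa using hs
  have hne : 1 + s ≠ 0 := by
    intro h0; rw [h0] at hs1; norm_num at hs1
  have hs0 : s ≠ 0 := by rintro rfl; simp at hs
  have hbm := bPsi_meas
  have i2 : IntegrableOn (fun t : ℝ => Complex.exp (-(s * t))) (Ioi 0) := by
    have := integrableOn_exp_mul_complex_Ioi (a := -s) (by simpa using hs) 0
    simpa using this
  have i1 : IntegrableOn (fun t : ℝ => (bPsi t : ℂ) * Complex.exp (-(s * t))) (Ioi 0) := by
    refine (i2.norm.const_mul (Real.log 4 + 4)).mono' (by fun_prop) ?_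
    filter_upwards with t
    rw [norm_mul, Complex.norm_real, Real.norm_of_nonneg (bPsi_nonneg t)]
    gcongr
    exact bPsi_le t
  have : ∫ t in Ioi (0:ℝ), (gPsi t : ℂ) * Complex.exp (-(s * t)) =
      ∫ t in Ioi (0:ℝ), ((bPsi t : ℂ) * Complex.exp (-(s * t)) - Complex.exp (-(s * t))) := by
    apply setIntegral_congr_fun measurableSet_Ioi
    intro t ht
    simp only [gPsi, indicator_of_mem ht]
    push_cast; ring
  rw [this, integral_sub i1 i2, bPsi_laplace hs]
  have e := integral_exp_mul_complex_Ioi (a := -s) (by simpa using hs) 0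
  have e' : ∫ t in Ioi (0:ℝ), Complex.exp (-(s * t)) = 1 / s := by
    simpa [div_neg, neg_div] using e
  rw [e']
  field_simp; ring

lemma bPsi_tendsto : Tendsto bPsi atTop (𝓝 1) := by
  have hgm : Measurable gPsi := (bPsi_meas.sub_const 1).indicator measurableSet_Ioi
  have hM : ∀ t, |gPsi t| ≤ Real.log 4 + 5 := by
    intro t
    have h4 : 0 < Real.log 4 := Real.log_pos (by norm_num)
    by_cases ht : t ∈ Ioi (0:ℝ)
    · simp only [gPsi, indicator_of_mem ht]
      rw [abs_le]; constructor <;> linarith [bPsi_le t, bPsi_nonneg t]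
    · simp only [gPsi, indicator_of_notMem ht, abs_zero]; linarith
  refine taub_main hgm hM (fun t ht => by simp [gPsi, ht]) ?_ bPsi_nonneg ?_
  · intro t u htu
    have : ∀ t, bPsi t * Real.exp t = Chebyshev.psi (Real.exp t) := by
      intro t; rw [bPsi, mul_assoc, ← Real.exp_add]; simp
    rw [this, this]
    exact Chebyshev.psi_mono (Real.exp_le_exp.2 htu)
  · intro l hl
    refine smooth_tendsto hgm hM (fun t ht => by simp [gPsi, ht])
      (G := fun s => (auxL (1 + s) - 1) / (1 + s)) (fun s hs => gPsi_laplace hs) ?_ hl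
    apply ContinuousOn.div
    · refine ContinuousOn.sub ?_ continuousOn_const
      refine auxL_cont.comp (by fun_prop) ?_
      intro s hs
      simpa using hs
    · fun_prop
    · intro s hs h0
      have h1 := congrArg Complex.re h0
      have : 0 ≤ s.re := hs
      simp at h1
      linarith

lemma psi_div_tendsto : Tendsto (fun x => Chebyshev.psi x / x) atTop (𝓝 1) := by
  refine (bPsi_tendsto.comp Real.tendsto_log_atTop).congr' ?_
  filter_upwards [eventually_gt_atTop 0] with x hx
  simp [bPsi, Real.exp_neg, Real.exp_log hx, div_eq_mul_inv]

lemma theta_div_tendsto : Tendsto (fun x => Chebyshev.theta x / x) atTop (𝓝 1) := by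
  have h : Tendsto (fun x => (Chebyshev.psi x - Chebyshev.theta x) / x) atTop (𝓝 0) := by
    have h1 := Chebyshev.isBigO_psi_sub_theta_sqrt
    have h2 : Real.sqrt =o[atTop] (fun x : ℝ => x) := by
      rw [Asymptotics.isLittleO_iff_tendsto' (by
        filter_upwards [eventually_gt_atTop 0] with x hx h0; exact absurd h0 hx.ne')]
      refine (tendsto_inv_atTop_zero.comp Real.tendsto_sqrt_atTop).congr fun x => ?_
      simp [Real.sqrt_div_self]
    exact (h1.trans_isLittleO h2).tendsto_div_nhds_zero
  have := psi_div_tendsto.sub h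
  rw [sub_zero] at this
  refine this.congr fun x => ?_
  ring

lemma pi_tendsto : Tendsto (fun x : ℝ => (Nat.primeCounting ⌊x⌋₊ : ℝ) * Real.log x / x) atTop (𝓝 1) := by
  have h := Chebyshev.integral_theta_div_log_sq_isLittleO.tendsto_div_nhds_zero
  have := theta_div_tendsto.add h
  rw [add_zero] at this
  refine this.congr' ?_
  filter_upwards [eventually_ge_atTop 2] with x hx
  have : 0 < Real.log x := Real.log_pos (by linarith)
  rw [Chebyshev.primeCounting_eq_theta_div_log_add_integral hx]
  field_simp

lemma nthPrime_tendsto : Tendsto (fun n : ℕ => (Nat.nth Nat.Prime (n - 1) : ℝ) / (n * Real.log n)) atTop (𝓝 1) := by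
  let P : ℕ → ℝ := fun n => (Nat.nth Nat.Prime (n - 1) : ℝ)
  have hP : Tendsto P atTop atTop := by
    have h1 : Tendsto (Nat.nth Nat.Prime) atTop atTop := (Nat.nth_strictMono Nat.infinite_setOfPred_prime).tendsto_atTop
    exact tendsto_natCast_atTop_atTop.comp (h1.comp (tendsto_sub_atTop_nat 1))
  have h1 : Tendsto (fun n : ℕ => (n : ℝ) * Real.log (P n) / P n) atTop (𝓝 1) := by
    refine (pi_tendsto.comp hP).congr' ?_
    filter_upwards [eventually_ge_atTop 1] with n hn
    have : Nat.primeCounting (Nat.nth Nat.Prime (n - 1)) = n := by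
      rw [Nat.primeCounting, Nat.primeCounting', Nat.count_succ, if_pos (Nat.prime_nth_prime _), Nat.count_nth_of_infinite Nat.infinite_setOfPred_prime]
      omega
    simp [P, this]
  have hlP : Tendsto (fun n => Real.log (P n)) atTop atTop := Real.tendsto_log_atTop.comp hP
  -- log n / log P → 1
  have h2 : Tendsto (fun n : ℕ => Real.log n / Real.log (P n)) atTop (𝓝 1) := by
    have e1 : Tendsto (fun n : ℕ => Real.log ((n : ℝ) * Real.log (P n) / P n)) atTop (𝓝 0) := by
      simpa using h1.log one_ne_zero
    have e2 := e1.div_atTop hlP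
    have e3 : Tendsto (fun n : ℕ => Real.log (Real.log (P n)) / Real.log (P n)) atTop (𝓝 0) :=
      Real.isLittleO_log_id_atTop.tendsto_div_nhds_zero.comp hlP
    have e4 := (e2.sub e3).add_const 1
    simp only [sub_zero, zero_add] at e4
    refine e4.congr' ?_
    filter_upwards [eventually_ge_atTop 1, hP.eventually_gt_atTop 1] with n hn hn2
    have hl : 0 < Real.log (P n) := Real.log_pos hn2
    have hn0 : (n : ℝ) ≠ 0 := by positivity
    rw [Real.log_div (by positivity) (by positivity), Real.log_mul hn0 hl.ne']
    field_simp; ring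
  have h3 := (h1.mul h2).inv₀ (by norm_num)
  simp only [mul_one, inv_one] at h3
  refine h3.congr' ?_
  filter_upwards [eventually_ge_atTop 2, hP.eventually_gt_atTop 1] with n hn hn2
  have hl : 0 < Real.log (P n) := Real.log_pos hn2
  have : 0 < Real.log n := Real.log_pos (by exact_mod_cast hn)
  have hn0 : (n : ℝ) ≠ 0 := by positivity
  have : P n ≠ 0 := by positivity
  show _ = P n / _
  field_simp

lemma two_mul_tendsto : Tendsto (fun k : ℕ => 2 * k) atTop atTop :=
  tendsto_id.const_mul_atTop' (by norm_num)

lemma p_ratio : Tendsto (fun n : ℕ => p n / (n * Real.log n)) atTop (𝓝 1) := nthPrime_tendsto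

lemma log_diff_tendsto :
    Tendsto (fun n : ℕ => (n : ℝ) * Real.log (n + 1) - n * Real.log n) atTop (𝓝 1) := by
  have h := (Real.tendsto_mul_log_one_add_div_atTop 1).comp tendsto_natCast_atTop_atTop (α := ℕ)
  refine h.congr' ?_
  filter_upwards [eventually_ge_atTop 1] with n hn
  have hn0 : (0:ℝ) < n := by positivity
  have : 1 + 1 / (n:ℝ) = (n + 1) / n := by field_simp
  simp only [Function.comp_apply]
  rw [this, Real.log_div (by positivity) (by positivity)]
  ring

end PNT

open Filter in
theorem twin_prime_related_limits :
    Filter.Tendsto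
      (fun k : ℕ => p (2 * k) *
        (((fun n : ℕ => if Even n then (n : ℝ) * Real.log n else ((n : ℝ) - 1) * Real.log n)
            (2 * k + 1) -
          (fun n : ℕ => if Even n then (n : ℝ) * Real.log n else ((n : ℝ) - 1) * Real.log n)
            (2 * k) + 1) /
          (fun n : ℕ => if Even n then (n : ℝ) * Real.log n else ((n : ℝ) - 1) * Real.log n)
            (2 * k))) Filter.atTop (nhds 2) ∧
    Filter.Tendsto
      (fun k : ℕ => p (2 * k + 1) *
        (((fun n : ℕ => if Even n then (n : ℝ) * Real.log n else ((n : ℝ) - 1) * Real.log n)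
            (2 * k + 2) -
          (fun n : ℕ => if Even n then (n : ℝ) * Real.log n else ((n : ℝ) - 1) * Real.log n)
            (2 * k + 1) + 1) /
          (fun n : ℕ => if Even n then (n : ℝ) * Real.log n else ((n : ℝ) - 1) * Real.log n)
            (2 * k + 1))) Filter.atTop Filter.atTop := by
  have hodd : ∀ k : ℕ, ¬ Even (2 * k + 1) := fun k => by simp
  have heven : ∀ k : ℕ, Even (2 * k) := fun k => by simp
  have heven2 : ∀ k : ℕ, Even (2 * k + 2) := fun k => by
    rw [show 2 * k + 2 = 2 * (k + 1) by ring]; simp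
  simp only [hodd, heven, heven2, if_true, if_false]
  constructor
  · have h := (p_ratio.mul (log_diff_tendsto.add_const 1)).comp two_mul_tendsto
    norm_num at h
    refine h.congr fun k => ?_
    simp only [Function.comp_apply]
    push_cast
    ring_nf
  · have hs : Tendsto (fun k : ℕ => 2 * k + 1) atTop atTop :=
      (tendsto_add_atTop_nat 1).comp two_mul_tendsto
    have h1 := p_ratio.comp hs
    have h2 : Tendsto (fun k : ℕ => 2 * Real.log ((2 * k + 1 : ℕ) : ℝ)) atTop atTop :=
      (Real.tendsto_log_atTop.comp (tendsto_natCast_atTop_atTop.comp hs)).const_mul_atTop (by norm_num)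
    have h3 := h1.pos_mul_atTop one_pos h2
    refine tendsto_atTop_mono' _ ?_ h3
    filter_upwards [eventually_ge_atTop 1] with k hk
    simp only [Function.comp_apply]
    have hk' : (1:ℝ) ≤ k := by exact_mod_cast hk
    have hp : 0 ≤ p (2 * k + 1) := Nat.cast_nonneg _
    push_cast
    have hL : 0 < Real.log (2 * k + 1) := Real.log_pos (by linarith)
    have hLL : Real.log (2 * k + 1) ≤ Real.log (2 * k + 2) := Real.log_le_log (by linarith) (by linarith)
    rw [div_mul_eq_mul_div, mul_div_assoc]
    refine mul_le_mul_of_nonneg_left ?_ hp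
    apply div_le_div₀
    · nlinarith
    · nlinarith
    · exact mul_pos (by linarith) hL
    · exact mul_le_mul_of_nonneg_right (by linarith) hL.le
end
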